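/- arXiv:1606.02150 — 5 statements merged into one kernel-verified Lean document; each statement's English description precedes it below -/
import Mathlib

section
/- For every complex number s with 0 < Re(s) < 1, the improper integral ∫₀^∞ x^{-s-1}(coth x − 1/x) dx converges and ζ(s+1) = cos(πs/2) · π^s · ∫₀^∞ x^{-s-1}(coth x − 1/x) dx. -/
open Real MeasureTheory

open Set in
/-- The Beta integral in the form `∫₀^∞ x^(u-1) / (1 + x) dx = π / sin(πu)`. -/
lemma integrableOn_and_integral_cpow_div_one_add {u : ℂ} (h0 : 0 < u.re) (h1 : u.re < 1) :
    IntegrableOn (fun x : ℝ => (x : ℂ) ^ (u - 1) / (1 + x)) (Ioi 0) ∧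
    ∫ x in Ioi (0 : ℝ), (x : ℂ) ^ (u - 1) / (1 + x) = π / Complex.sin (π * u) := by
  have hv : 0 < (1 - u).re := by simpa using h1
  set g : ℝ → ℂ := fun x => (x : ℂ) ^ (u - 1) * (1 - (x : ℂ)) ^ ((1 - u) - 1) with hg
  have hd : ∀ x ∈ Ioi (0 : ℝ),
      HasDerivWithinAt (fun x : ℝ => x / (1 + x)) (1 / (1 + x) ^ 2) (Ioi 0) x := by
    intro x hx
    have hx' : 1 + x ≠ 0 := by have := mem_Ioi.mp hx; positivity
    have := (hasDerivAt_id x).div ((hasDerivAt_id x).const_add 1) hx'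
    refine (this.congr_deriv ?_).hasDerivWithinAt
    simp
  have hinj : InjOn (fun x : ℝ => x / (1 + x)) (Ioi 0) := by
    intro x hx y hy h
    have hx' := mem_Ioi.mp hx
    have hy' := mem_Ioi.mp hy
    have h' : x / (1 + x) = y / (1 + y) := h
    rw [div_eq_div_iff (by positivity) (by positivity)] at h'
    linarith
  have himg : (fun x : ℝ => x / (1 + x)) '' Ioi 0 = Ioo 0 1 := by
    ext y
    constructor
    · rintro ⟨x, hx, rfl⟩
      have hx' := mem_Ioi.mp hx
      exact ⟨by positivity, by rw [div_lt_one (by positivity)]; linarith⟩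
    · rintro ⟨hy0, hy1⟩
      have : 0 < 1 - y := by linarith
      refine ⟨y / (1 - y), div_pos hy0 this, ?_⟩
      field_simp
      ring
  have hcongr : EqOn (fun x : ℝ => |1 / (1 + x) ^ 2| • g (x / (1 + x)))
      (fun x : ℝ => (x : ℂ) ^ (u - 1) / (1 + x)) (Ioi 0) := by
    intro x hx
    have hx' := mem_Ioi.mp hx
    have hp : 0 < 1 + x := by positivity
    have hpc : (1 + x : ℂ) ≠ 0 := by exact_mod_cast hp.ne'
    have e1 : (1 - ((x / (1 + x) : ℝ) : ℂ)) = (((1 + x)⁻¹ : ℝ) : ℂ) := by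
      push_cast; field_simp; ring
    have e2 : (1 + x : ℂ) ^ (u - 1) = (1 + x) ^ u / (1 + x) := by
      rw [Complex.cpow_sub _ _ hpc, Complex.cpow_one]
    have hne : (1 + x : ℂ) ^ u ≠ 0 := by simp [Complex.cpow_eq_zero_iff, hpc]
    have harg : (1 + x : ℂ).arg ≠ π := by
      have := Complex.arg_ofReal_of_nonneg hp.le
      push_cast at this
      rw [this]; exact pi_pos.ne
    simp only [hg]
    rw [e1, abs_of_pos (by positivity), show (1 - u) - 1 = -u by ring, div_eq_mul_inv x,
      Complex.ofReal_mul, Complex.mul_cpow_ofReal_nonneg hx'.le (by positivity), Complex.real_smul]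
    push_cast
    rw [Complex.inv_cpow _ _ harg, Complex.inv_cpow _ _ harg, e2, Complex.cpow_neg]
    field_simp
  have hint : IntegrableOn g (Ioo 0 1) := by
    have := Complex.betaIntegral_convergent h0 hv
    rw [intervalIntegrable_iff_integrableOn_Ioo_of_le zero_le_one] at this
    exact this
  constructor
  · rw [← himg, integrableOn_image_iff_integrableOn_abs_deriv_smul measurableSet_Ioi hd hinj]
      at hint
    exact hint.congr_fun hcongr measurableSet_Ioi
  · rw [← setIntegral_congr_fun measurableSet_Ioi hcongr,
      ← integral_image_eq_integral_abs_deriv_smul measurableSet_Ioi hd hinj, himg,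
      ← Complex.Gamma_mul_Gamma_one_sub, Complex.Gamma_mul_Gamma_eq_betaIntegral h0 hv,
      add_sub_cancel, Complex.Gamma_one, one_mul, Complex.betaIntegral,
      intervalIntegral.integral_of_le zero_le_one, integral_Ioc_eq_integral_Ioo]

open Set in
lemma integrableOn_and_integral_cpow_mul_div_sq_add_sq {s : ℂ} (h0 : -1 < s.re) (h1 : s.re < 1)
    {a : ℝ} (ha : 0 < a) :
    IntegrableOn (fun x : ℝ => (x : ℂ) ^ (-s - 1) * ((2 * x / (x ^ 2 + a ^ 2) : ℝ) : ℂ)) (Ioi 0) ∧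
    ∫ x in Ioi (0 : ℝ), (x : ℂ) ^ (-s - 1) * ((2 * x / (x ^ 2 + a ^ 2) : ℝ) : ℂ) =
      (a : ℂ) ^ (-s - 1) * (π / Complex.cos (π * s / 2)) := by
  set u : ℂ := (1 - s) / 2 with hu
  have hre : u.re = (1 - s.re) / 2 := by
    rw [hu, show (1 - s) / 2 = (1 - s) / ((2 : ℝ) : ℂ) by norm_num, Complex.div_ofReal_re]; simp
  obtain ⟨hi, hv⟩ := integrableOn_and_integral_cpow_div_one_add (u := u)
    (by rw [hre]; linarith) (by rw [hre]; linarith)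
  have hsin : Complex.sin (π * u) = Complex.cos (π * s / 2) := by
    rw [← Complex.cos_pi_div_two_sub, hu]; congr 1; ring
  set h : ℝ → ℂ := fun x => (x : ℂ) ^ (u - 1) / (1 + x) with hh
  set k : ℝ → ℂ := fun x => ((2 : ℝ) * x ^ ((2 : ℝ) - 1)) • h (x ^ (2 : ℝ)) with hk
  have hac : (a : ℂ) ≠ 0 := by exact_mod_cast ha.ne'
  have hki : IntegrableOn k (Ioi 0) := by
    have := (integrableOn_Ioi_comp_rpow_iff h (p := 2) two_ne_zero).mpr hi
    simpa only [abs_two] using this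
  have hkv : ∫ x in Ioi 0, k x = π / Complex.cos (π * s / 2) := by
    rw [hk, integral_comp_rpow_Ioi_of_pos two_pos, hv, hsin]
  have hcongr : EqOn (fun x : ℝ => (a : ℂ) ^ (-s - 2) * k (a⁻¹ * x))
      (fun x : ℝ => (x : ℂ) ^ (-s - 1) * ((2 * x / (x ^ 2 + a ^ 2) : ℝ) : ℂ)) (Ioi 0) := by
    intro x hx
    have hx' := mem_Ioi.mp hx
    have hxc : (x : ℂ) ≠ 0 := by exact_mod_cast hx'.ne'
    have hd : (x ^ 2 + a ^ 2 : ℂ) ≠ 0 := by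
      have : x ^ 2 + a ^ 2 ≠ 0 := by positivity
      exact_mod_cast this
    have hd' : (a ^ 2 + x ^ 2 : ℂ) ≠ 0 := by rwa [add_comm]
    have hpow : ∀ y : ℝ, 0 < y → ((y ^ (2 : ℝ) : ℝ) : ℂ) ^ (u - 1) = (y : ℂ) ^ (-s - 1) := by
      intro y hy
      rw [← Complex.cpow_mul_ofReal_nonneg hy.le]
      congr 1
      rw [hu]; push_cast; ring
    have hy : 0 < a⁻¹ * x := by positivity
    have harg : (a : ℂ).arg ≠ π := by
      rw [Complex.arg_ofReal_of_nonneg ha.le]; exact pi_pos.ne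
    have e1 : (a : ℂ) ^ (-s - 2) = (a : ℂ) ^ (-s - 1) / a := by
      rw [show -s - 2 = (-s - 1) - 1 by ring, Complex.cpow_sub _ 1 hac, Complex.cpow_one]
    have hne : (a : ℂ) ^ (-s - 1) ≠ 0 := by simp [Complex.cpow_eq_zero_iff, hac]
    simp only [hk, hh]
    rw [hpow _ hy, Complex.ofReal_mul, Complex.mul_cpow_ofReal_nonneg (by positivity) hx'.le,
      Complex.ofReal_inv, Complex.inv_cpow _ _ harg, e1, Complex.real_smul,
      show (2 : ℝ) - 1 = 1 by norm_num, Real.rpow_one, Real.rpow_two]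
    push_cast
    field_simp
    ring
  constructor
  · refine IntegrableOn.congr_fun ?_ hcongr measurableSet_Ioi
    refine Integrable.const_mul ?_ _
    have := (integrableOn_Ioi_comp_mul_left_iff k 0 (inv_pos.mpr ha))
    rw [mul_zero] at this
    exact this.mpr hki
  · rw [← setIntegral_congr_fun measurableSet_Ioi hcongr, integral_const_mul,
      integral_comp_mul_left_Ioi k 0 (inv_pos.mpr ha), mul_zero, hkv, inv_inv, Complex.real_smul,
      show -s - 1 = (-s - 2) + 1 by ring, Complex.cpow_add _ _ hac, Complex.cpow_one]
    ring

/-- The Mittag-Leffler expansion of `coth x - 1 / x`. -/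
lemma hasSum_coth_sub_inv {x : ℝ} (hx : 0 < x) :
    HasSum (fun n : ℕ => 2 * x / (x ^ 2 + (π * (n + 1)) ^ 2))
      (Real.cosh x / Real.sinh x - 1 / x) := by
  set z : ℂ := x * Complex.I / π with hz
  have hpi : (π : ℂ) ≠ 0 := by exact_mod_cast pi_ne_zero
  have hxc : (x : ℂ) ≠ 0 := by exact_mod_cast hx.ne'
  have him : z.im = x / π := by rw [hz, Complex.div_ofReal_im]; simp
  have hzc : z ∈ Complex.integerComplement := by
    rw [Complex.mem_integerComplement_iff]
    rintro ⟨n, hn⟩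
    have : z.im = 0 := by rw [← hn]; simp
    rw [him] at this
    have : 0 < x / π := by positivity
    linarith
  have hs := (summable_cotTerm hzc).hasSum
  rw [← cot_series_rep' hzc] at hs
  have hs2 := hs.mul_left (Complex.I / π)
  rw [← Complex.hasSum_ofReal]
  have hsinh : Complex.sinh x ≠ 0 := by
    rw [← Complex.ofReal_sinh]
    exact_mod_cast (Real.sinh_pos_iff.mpr hx).ne'
  convert! hs2 using 1
  · funext n
    have hd : (x ^ 2 + (π * (n + 1)) ^ 2 : ℂ) ≠ 0 := by
      have : x ^ 2 + (π * (n + 1)) ^ 2 ≠ 0 := by positivity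
      exact_mod_cast this
    have e1 : z - (n + 1) ≠ 0 := fun h => by
      have := congrArg Complex.im h
      simp [him, hx.ne', pi_ne_zero] at this
    have e2 : z + (n + 1) ≠ 0 := fun h => by
      have := congrArg Complex.im h
      simp [him, hx.ne', pi_ne_zero] at this
    have e3 : (z - (n + 1)) * (z + (n + 1)) = -(x ^ 2 + (π * (n + 1)) ^ 2) / π ^ 2 := by
      rw [hz]; field_simp; ring_nf; rw [Complex.I_sq]; ring
    rw [cotTerm, div_add_div _ _ e1 e2, e3]
    push_cast
    have : (1 : ℂ) * (z + (n + 1)) + (z - (n + 1)) * 1 = 2 * x * Complex.I / π := by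
      rw [hz]; ring
    rw [this]
    field_simp
    rw [Complex.I_sq]
    ring
  · have : (π : ℂ) * z = x * Complex.I := by rw [hz]; field_simp
    rw [this, Complex.cot, Complex.cos_mul_I, Complex.sin_mul_I, hz]
    push_cast
    field_simp

open Set in
lemma hasSum_integral_coth {s : ℂ} (h0 : 0 < s.re) (h1 : s.re < 1) :
    HasSum (fun n : ℕ => ((π * (n + 1) : ℝ) : ℂ) ^ (-s - 1) * (π / Complex.cos (π * s / 2)))
      (∫ x in Ioi (0 : ℝ), (x : ℂ) ^ (-s - 1) *
        ((Real.cosh x / Real.sinh x - 1 / x : ℝ) : ℂ)) := by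
  have hpos (n : ℕ) : 0 < π * (n + 1) := by positivity
  have hF (n : ℕ) := integrableOn_and_integral_cpow_mul_div_sq_add_sq
    (s := s) (by linarith) h1 (hpos n)
  have hR (n : ℕ) := (integrableOn_and_integral_cpow_mul_div_sq_add_sq
    (s := (s.re : ℂ)) (by rw [Complex.ofReal_re]; linarith) (by simpa using h1) (hpos n)).2
  have key := hasSum_integral_of_summable_integral_norm (fun n => (hF n).1) ?_
  · simp_rw [(hF _).2] at key
    convert! key using 1
    refine setIntegral_congr_fun measurableSet_Ioi fun x hx => ?_
    exact (((Complex.hasSum_ofReal.mpr (hasSum_coth_sub_inv hx)).mul_left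
      ((x : ℂ) ^ (-s - 1))).tsum_eq).symm
  · rw [← Complex.summable_ofReal]
    have heq (n : ℕ) : ((∫ x in Ioi (0 : ℝ), ‖(x : ℂ) ^ (-s - 1) *
        ((2 * x / (x ^ 2 + (π * (n + 1)) ^ 2) : ℝ) : ℂ)‖ : ℝ) : ℂ) =
        ((1 / (n + 1 : ℝ) ^ (s.re + 1) : ℝ) : ℂ) *
          ((π : ℂ) ^ (-(s.re : ℂ) - 1) * (π / Complex.cos (π * s.re / 2))) := by
      rw [← integral_complex_ofReal]
      trans ∫ x in Ioi (0 : ℝ), (x : ℂ) ^ (-(s.re : ℂ) - 1) *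
        ((2 * x / (x ^ 2 + (π * (n + 1)) ^ 2) : ℝ) : ℂ)
      · refine setIntegral_congr_fun measurableSet_Ioi fun x hx => ?_
        have hx' := mem_Ioi.mp hx
        rw [norm_mul, Complex.norm_cpow_eq_rpow_re_of_pos hx', Complex.norm_real,
          Real.norm_of_nonneg (by positivity), Complex.ofReal_mul, Complex.ofReal_cpow hx'.le]
        simp
      · rw [hR n, Complex.ofReal_mul, Complex.mul_cpow_ofReal_nonneg pi_pos.le (by positivity),
          one_div, ← Real.rpow_neg (by positivity), Complex.ofReal_cpow (by positivity)]
        push_cast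
        rw [show -((s.re : ℂ) + 1) = -s.re - 1 by ring]
        ring
    simp_rw [heq]
    refine Summable.mul_right _ ?_
    rw [Complex.summable_ofReal]
    have := (summable_nat_add_iff 1).mpr
      (Real.summable_one_div_nat_rpow.mpr (by linarith : 1 < s.re + 1))
    exact_mod_cast this

open Set in
lemma riemannZeta_add_one_eq_integral_coth {s : ℂ} (h0 : 0 < s.re) (h1 : s.re < 1) :
    riemannZeta (s + 1) = Complex.cos ((π : ℂ) * s / 2) * (π : ℂ) ^ s *
      ∫ x in Ioi (0 : ℝ), (x : ℂ) ^ (-s - 1) *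
        ((Real.cosh x / Real.sinh x - 1 / x : ℝ) : ℂ) := by
  have hpi : (π : ℂ) ≠ 0 := by exact_mod_cast pi_ne_zero
  have hcos : Complex.cos (π * s / 2) ≠ 0 := by
    rw [Complex.cos_ne_zero_iff]
    intro k hk
    have h : s = ((2 * k + 1 : ℤ) : ℂ) := by
      push_cast
      field_simp at hk
      exact hk
    rw [h, Complex.intCast_re] at h0 h1
    have a : 0 < 2 * k + 1 := by exact_mod_cast h0
    have b : 2 * k + 1 < 1 := by exact_mod_cast h1
    omega
  rw [← (hasSum_integral_coth h0 h1).tsum_eq, ← tsum_mul_left,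
    zeta_eq_tsum_one_div_nat_add_one_cpow (by simpa using h0)]
  refine tsum_congr fun n => ?_
  rw [Complex.ofReal_mul, Complex.mul_cpow_ofReal_nonneg pi_pos.le (by positivity),
    show -s - 1 = -(s + 1) by ring, Complex.cpow_neg, Complex.cpow_neg,
    Complex.cpow_add s 1 hpi, Complex.cpow_one]
  have : (π : ℂ) ^ s ≠ 0 := by simp [Complex.cpow_eq_zero_iff, hpi]
  generalize Complex.cos (π * s / 2) = c at hcos ⊢
  push_cast
  field_simp

open Set in
lemma integrableOn_cpow_mul_coth {s : ℂ} (h0 : 0 < s.re) (h1 : s.re < 1) :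
    IntegrableOn (fun x : ℝ => (x : ℂ) ^ (-s - 1) *
      ((Real.cosh x / Real.sinh x - 1 / x : ℝ) : ℂ)) (Ioi 0) := by
  have hreal : IntegrableOn (fun x : ℝ => (x : ℂ) ^ (-(s.re : ℂ) - 1) *
      ((Real.cosh x / Real.sinh x - 1 / x : ℝ) : ℂ)) (Ioi 0) := by
    by_contra h
    have hz := riemannZeta_add_one_eq_integral_coth (s := (s.re : ℂ)) (by simpa using h0)
      (by simpa using h1)
    rw [integral_undef h, mul_zero] at hz
    exact riemannZeta_ne_zero_of_one_lt_re (by simpa using h0) hz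
  have hmeas : Measurable (fun x : ℝ => (x : ℂ) ^ (-s - 1) *
      ((Real.cosh x / Real.sinh x - 1 / x : ℝ) : ℂ)) := by fun_prop
  refine Integrable.mono hreal hmeas.aestronglyMeasurable ?_
  refine (ae_restrict_iff' measurableSet_Ioi).mpr (.of_forall fun x hx => ?_)
  rw [norm_mul, norm_mul, Complex.norm_cpow_eq_rpow_re_of_pos hx,
    Complex.norm_cpow_eq_rpow_re_of_pos hx]
  simp

/-- For every complex `s` with `0 < Re s < 1`, the integral
`∫₀^∞ x^(-s-1) (coth x - 1/x) dx` converges and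
`ζ(s+1) = cos(πs/2) · π^s · ∫₀^∞ x^(-s-1) (coth x - 1/x) dx`. -/
theorem zeta_coth_integral_rep (s : ℂ) (h0 : 0 < s.re) (h1 : s.re < 1) :
    IntegrableOn (fun x : ℝ => (x : ℂ) ^ (-s - 1) *
      ((Real.cosh x / Real.sinh x - 1 / x : ℝ) : ℂ)) (Set.Ioi 0) ∧
    riemannZeta (s + 1) = Complex.cos ((π : ℂ) * s / 2) * (π : ℂ) ^ s *
      ∫ x in Set.Ioi (0 : ℝ), (x : ℂ) ^ (-s - 1) *
        ((Real.cosh x / Real.sinh x - 1 / x : ℝ) : ℂ) :=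
  ⟨integrableOn_cpow_mul_coth h0 h1, riemannZeta_add_one_eq_integral_coth h0 h1⟩
end

section
/- For every complex number s with 0 < Re(s) < 2, the improper integral ∫₀^∞ x^{-s-1}(coth²x − 1/x² − 2/3) dx converges and ζ(s+2) = (π^{s+1} sin(πs/2)/(s+1)) · ∫₀^∞ x^{-s-1}(coth²x − 1/x² − 2/3) dx. -/
open Real MeasureTheory

/-- The map `x ↦ x / (1 + x)` sends `(0, ∞)` onto `(0, 1)`. -/
lemma image_div_one_add_Ioi :
    (fun x : ℝ => x / (1 + x)) '' Set.Ioi 0 = Set.Ioo 0 1 := by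
  ext y
  simp only [Set.mem_image, Set.mem_Ioi, Set.mem_Ioo]
  constructor
  · rintro ⟨x, hx, rfl⟩
    exact ⟨by positivity, by rw [div_lt_one (by positivity)]; linarith⟩
  · rintro ⟨h0, h1⟩
    have h2 : 0 < 1 - y := by linarith
    exact ⟨y / (1 - y), by positivity, by field_simp; ring⟩

/-- Euler's second form of the Beta integral, as a Mellin transform. -/
lemma hasMellin_one_add_cpow_neg {u v : ℂ} (hu : 0 < u.re) (hv : 0 < v.re) :
    HasMellin (fun x : ℝ => ((1 + x : ℝ) : ℂ) ^ (-(u + v))) u (u.betaIntegral v) := by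
  have hderiv : ∀ x ∈ Set.Ioi (0 : ℝ),
      HasDerivWithinAt (fun x : ℝ => x / (1 + x)) (1 / (1 + x) ^ 2) (Set.Ioi 0) x := by
    intro x hx
    have hx' : (1 + x) ≠ 0 := by have := Set.mem_Ioi.1 hx; positivity
    refine (((hasDerivAt_id x).div ((hasDerivAt_id x).const_add 1) hx').congr_deriv
      ?_).hasDerivWithinAt
    simp
  have hinj : Set.InjOn (fun x : ℝ => x / (1 + x)) (Set.Ioi 0) := by
    intro x hx y hy h
    have hx' : (1 + x) ≠ 0 := by have := Set.mem_Ioi.1 hx; positivity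
    have hy' : (1 + y) ≠ 0 := by have := Set.mem_Ioi.1 hy; positivity
    simp only at h
    rw [div_eq_div_iff hx' hy'] at h
    linarith
  have hpt : ∀ x ∈ Set.Ioi (0 : ℝ), |1 / (1 + x) ^ 2| •
      (((x / (1 + x) : ℝ) : ℂ) ^ (u - 1) * (1 - ((x / (1 + x) : ℝ) : ℂ)) ^ (v - 1)) =
      (x : ℂ) ^ (u - 1) • ((1 + x : ℝ) : ℂ) ^ (-(u + v)) := by
    intro x hx
    have hx : 0 < x := hx
    have h1 : 0 < 1 + x := by positivity
    have hc : ((1 + x : ℝ) : ℂ) ≠ 0 := by exact_mod_cast h1.ne'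
    have e1 : (1 - ((x / (1 + x) : ℝ) : ℂ)) = (((1 + x)⁻¹ : ℝ) : ℂ) := by
      rw [← Complex.ofReal_one, ← Complex.ofReal_sub]
      congr 1
      field_simp
      ring
    rw [e1, div_eq_mul_inv x, Complex.ofReal_mul,
      Complex.mul_cpow_ofReal_nonneg hx.le (by positivity), abs_of_pos (by positivity)]
    simp only [Complex.real_smul, smul_eq_mul]
    have e2 : ∀ w : ℂ, (((1 + x)⁻¹ : ℝ) : ℂ) ^ w = ((1 + x : ℝ) : ℂ) ^ (-w) := by
      intro w
      rw [Complex.ofReal_inv, Complex.inv_cpow, Complex.cpow_neg]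
      rw [Complex.arg_ofReal_of_nonneg h1.le]
      exact pi_pos.ne
    have e3 : ((1 / (1 + x) ^ 2 : ℝ) : ℂ) = ((1 + x : ℝ) : ℂ) ^ (-2 : ℂ) := by
      rw [Complex.cpow_neg, Complex.cpow_ofNat]
      push_cast
      simp
    rw [e2, e2, e3, mul_assoc, ← Complex.cpow_add _ _ hc, mul_left_comm, ← Complex.cpow_add _ _ hc]
    congr 2
    ring
  have hconv := Complex.betaIntegral_convergent hu hv
  rw [intervalIntegrable_iff_integrableOn_Ioo_of_le zero_le_one, ← image_div_one_add_Ioi,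
    integrableOn_image_iff_integrableOn_abs_deriv_smul measurableSet_Ioi hderiv hinj,
    integrableOn_congr_fun hpt measurableSet_Ioi] at hconv
  refine ⟨hconv, ?_⟩
  rw [Complex.betaIntegral, intervalIntegral.integral_of_le zero_le_one,
    integral_Ioc_eq_integral_Ioo, ← image_div_one_add_Ioi,
    integral_image_eq_integral_abs_deriv_smul measurableSet_Ioi hderiv hinj,
    setIntegral_congr_fun measurableSet_Ioi hpt, mellin]

lemma HasMellin.comp_rpow {f : ℝ → ℂ} {s m : ℂ} {a : ℝ} (ha : a ≠ 0)
    (h : HasMellin f (s / a) m) : HasMellin (fun t => f (t ^ a)) s (|a|⁻¹ • m) :=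
  ⟨(MellinConvergent.comp_rpow ha).2 h.1, by rw [mellin_comp_rpow, h.2]⟩

lemma HasMellin.cpow_smul {f : ℝ → ℂ} {s a m : ℂ} (h : HasMellin f (s + a) m) :
    HasMellin (fun t : ℝ => (t : ℂ) ^ a • f t) s m :=
  ⟨MellinConvergent.cpow_smul.2 h.1, by rw [mellin_cpow_smul, h.2]⟩

/-- The kernel arising from the partial fraction expansion of `coth²`. -/
noncomputable def cothSqKernel (t : ℝ) : ℝ :=
  2 * t ^ 2 * (t ^ 2 + 3) / (t ^ 2 + 1) ^ 2

lemma cothSqKernel_eq_cpow (t : ℝ) (s : ℂ) :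
    (cothSqKernel t : ℂ) = (fun w : ℝ => (w : ℂ) ^ (1 : ℂ) •
      ((2 : ℂ) • ((1 + w : ℝ) : ℂ) ^ (-((1 - s / 2) + s / 2)) +
        (4 : ℂ) • ((1 + w : ℝ) : ℂ) ^ (-((1 - s / 2) + (1 + s / 2))))) (t ^ (2 : ℝ)) := by
  have h1 : (-((1 - s / 2) + s / 2)) = -1 := by ring
  have h2 : (-((1 - s / 2) + (1 + s / 2))) = -2 := by ring
  have h : ((1 + t ^ 2 : ℝ) : ℂ) ≠ 0 := by
    exact_mod_cast (by positivity : (1 + t ^ 2 : ℝ) ≠ 0)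
  simp only [h1, h2, Real.rpow_ofNat, Complex.cpow_one, Complex.cpow_neg, Complex.cpow_ofNat,
    smul_eq_mul, cothSqKernel]
  push_cast at h ⊢
  rw [add_comm ((t : ℂ) ^ 2) 1]
  field_simp
  ring

/-- The Mellin transform of the kernel. -/
lemma hasMellin_cothSqKernel {s : ℂ} (h0 : 0 < s.re) (h1 : s.re < 2) :
    HasMellin (fun t : ℝ => (cothSqKernel t : ℂ)) (-s)
      ((s + 1) * (π / Complex.sin (π * s / 2))) := by
  have hre : (s / 2).re = s.re / 2 := by simp
  have hu : 0 < (1 - s / 2).re := by rw [Complex.sub_re, hre, Complex.one_re]; linarith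
  have hv : 0 < (s / 2).re := by rw [hre]; linarith
  have hv' : 0 < (1 + s / 2).re := by rw [Complex.add_re, hre, Complex.one_re]; linarith
  have hA := hasMellin_one_add_cpow_neg hu hv
  have hB := hasMellin_one_add_cpow_neg hu hv'
  have hAB := hasMellin_add (hA.1.const_smul (2 : ℂ)) (hB.1.const_smul (4 : ℂ))
  rw [mellin_const_smul, mellin_const_smul, hA.2, hB.2] at hAB
  have harg : -s / ((2 : ℝ) : ℂ) + 1 = 1 - s / 2 := by push_cast; ring
  simp only [cothSqKernel_eq_cpow _ s]
  generalize hf : (fun t : ℝ => (2 : ℂ) • ((1 + t : ℝ) : ℂ) ^ (-((1 - s / 2) + s / 2)) +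
    (4 : ℂ) • ((1 + t : ℝ) : ℂ) ^ (-((1 - s / 2) + (1 + s / 2)))) = f at hAB
  rw [← harg] at hAB
  have h := hAB.cpow_smul.comp_rpow two_ne_zero
  rw [harg, ← hf] at h
  refine ⟨h.1, h.2.trans ?_⟩
  rw [Complex.betaIntegral_eq_Gamma_mul_div _ _ hu hv,
    Complex.betaIntegral_eq_Gamma_mul_div _ _ hu hv']
  have hs : s / 2 ≠ 0 := by
    intro h
    rw [h] at hv
    simp at hv
  rw [show 1 - s / 2 + s / 2 = 1 by ring, show 1 - s / 2 + (1 + s / 2) = 1 + 1 by ring,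
    Complex.Gamma_add_one 1 one_ne_zero, Complex.Gamma_one, add_comm 1 (s / 2),
    Complex.Gamma_add_one _ hs,
    show (π : ℂ) * s / 2 = π * (s / 2) by ring, ← Complex.Gamma_mul_Gamma_one_sub]
  simp only [smul_eq_mul, Complex.real_smul, abs_two]
  push_cast
  ring

lemma tsum_one_div_sq_eq_inv_sin_sq {z : ℂ} (hz : 0 < z.im) :
    ∑' n : ℤ, 1 / (z + n) ^ 2 = π ^ 2 / Complex.sin (π * z) ^ 2 := by
  have hz' : z ∈ UpperHalfPlane.upperHalfPlaneSet := hz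
  have h := iteratedDerivWithin_cot_pi_mul_eq_mul_tsum_div_pow le_rfl hz'
  rw [iteratedDerivWithin_one, derivWithin_of_isOpen UpperHalfPlane.isOpen_upperHalfPlaneSet hz'] at h
  have hsin : Complex.sin (π * z) ≠ 0 := by
    rw [Complex.sin_ne_zero_iff]
    intro k hk
    have := congrArg Complex.im hk
    simp [pi_ne_zero] at this
    exact hz.ne' this
  have hd : HasDerivAt (fun x : ℂ => (π : ℂ) * Complex.cot (π * x))
      (-(π ^ 2 / Complex.sin (π * z) ^ 2)) z := by
    have hl : HasDerivAt (fun x : ℂ => (π : ℂ) * x) π z := by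
      simpa using (hasDerivAt_id z).const_mul (π : ℂ)
    have := (((hl.ccos).div hl.csin hsin).const_mul (π : ℂ))
    refine (this.congr_deriv ?_)
    have := Complex.sin_sq_add_cos_sq (π * z)
    field_simp
    linear_combination (-1 : ℂ) * this
  rw [hd.deriv] at h
  simp only [pow_one, Nat.factorial_one, Nat.cast_one, mul_one, one_add_one_eq_two] at h
  linear_combination h

/-- Partial fractions for `coth²`. -/
lemma hasSum_coth_sq {x : ℝ} (hx : 0 < x) :
    HasSum (fun n : ℕ => cothSqKernel (((n + 1) * π)⁻¹ * x) / ((n + 1) * π) ^ 2)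
      ((cosh x / sinh x) ^ 2 - 1 / x ^ 2 - 2 / 3) := by
  have hsinh : sinh x ≠ 0 := (Real.sinh_pos_iff.2 hx).ne'
  set z : ℂ := (x / π : ℝ) * Complex.I with hz
  have hzim : 0 < z.im := by simp [hz]; positivity
  have hπ : (π : ℂ) ≠ 0 := by exact_mod_cast pi_ne_zero
  have hsum : Summable fun n : ℤ => 1 / (z + n) ^ 2 := by
    have := EisensteinSeries.linear_right_summable z 1 (k := 2) le_rfl
    refine this.congr fun n => ?_
    rw [Int.cast_one, one_mul, one_div]
    norm_cast
  have h := hsum.hasSum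
  rw [tsum_one_div_sq_eq_inv_sin_sq hzim] at h
  have hsinz : Complex.sin (π * z) = sinh x * Complex.I := by
    rw [hz, ← mul_assoc, Complex.sin_mul_I]
    push_cast
    rw [mul_div_cancel₀ _ hπ]
  have hN := (hasSum_nat_add_iff' 1).2 h.nat_add_neg
  rw [hsinz] at hN
  have hN' := hN.mul_left (-(1 / π ^ 2 : ℂ))
  have hζ := (Complex.hasSum_ofReal.2 ((hasSum_nat_add_iff' 1).2 hasSum_zeta_two)).mul_left
    (2 / π ^ 2 : ℂ)
  have hxπ : (x : ℂ) ≠ 0 := by exact_mod_cast hx.ne'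
  have hsinhc : (sinh x : ℂ) ≠ 0 := by exact_mod_cast hsinh
  have hz2 : z ^ 2 = -(x / π) ^ 2 := by
    rw [hz, mul_pow, Complex.I_sq]
    push_cast
    ring
  rw [← Complex.hasSum_ofReal]
  convert! hN'.add hζ using 1
  · ext n
    have hm : ((n : ℂ) + 1) ≠ 0 := by exact_mod_cast n.succ_ne_zero
    have hA : z + (n + 1) ≠ 0 := by
      intro h
      have := congrArg Complex.im h
      simp at this
      exact hzim.ne' this
    have hB : z - (n + 1) ≠ 0 := by
      intro h
      have := congrArg Complex.im h
      simp at this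
      exact hzim.ne' this
    have hden : ((x : ℂ) ^ 2 + ((n + 1) * π) ^ 2) ≠ 0 := by
      have : (x ^ 2 + ((n + 1) * π) ^ 2) ≠ 0 := by positivity
      exact_mod_cast this
    have hAB : 1 / (z + (n + 1)) ^ 2 + 1 / (z - (n + 1)) ^ 2 =
        2 * (z ^ 2 + (n + 1) ^ 2) / (z ^ 2 - (n + 1) ^ 2) ^ 2 := by
      have : z ^ 2 - ((n : ℂ) + 1) ^ 2 = (z + (n + 1)) * (z - (n + 1)) := by ring
      rw [this]
      field_simp
      ring
    have hAB' : 1 / (z + ((n + 1 : ℕ) : ℤ)) ^ 2 + 1 / (z + ((-((n + 1 : ℕ) : ℤ) : ℤ) : ℂ)) ^ 2 =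
        2 * π ^ 2 * (((n + 1) * π) ^ 2 - x ^ 2) / (x ^ 2 + ((n + 1) * π) ^ 2) ^ 2 := by
      have : z ^ 2 - ((n : ℂ) + 1) ^ 2 = -(x ^ 2 + ((n + 1) * π) ^ 2) / π ^ 2 := by
        rw [hz2]
        field_simp
        ring
      push_cast
      rw [← sub_eq_add_neg, hAB, this, hz2]
      field_simp
      ring
    rw [hAB', cothSqKernel]
    have e : ((((n : ℂ) + 1) * (π : ℂ))⁻¹ * (x : ℂ)) ^ 2 + 1 =
        (x ^ 2 + ((n + 1) * π) ^ 2) / ((n + 1) * π) ^ 2 := by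
      field_simp
    push_cast
    rw [e]
    rw [mul_pow] at hden
    field_simp
    ring
  · simp only [Finset.range_one, Finset.sum_singleton, Nat.cast_zero, Int.cast_zero, add_zero,
      neg_zero, mul_pow, Complex.I_sq, hz2]
    have hc := Real.cosh_sq x
    rw [div_pow, hc]
    push_cast at hsinhc ⊢
    field_simp
    ring

theorem zeta_coth_sq_integral_rep (s : ℂ) (h0 : 0 < s.re) (h1 : s.re < 2) :
    IntegrableOn (fun x : ℝ => (x : ℂ) ^ (-s - 1) *
      (((Real.cosh x / Real.sinh x) ^ 2 - 1 / x ^ 2 - 2 / 3 : ℝ) : ℂ)) (Set.Ioi 0) ∧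
    riemannZeta (s + 2) = (π : ℂ) ^ (s + 1) * Complex.sin ((π : ℂ) * s / 2) / (s + 1) *
      ∫ x in Set.Ioi (0 : ℝ), (x : ℂ) ^ (-s - 1) *
        (((Real.cosh x / Real.sinh x) ^ 2 - 1 / x ^ 2 - 2 / 3 : ℝ) : ℂ) := by
  obtain ⟨hconv, hval⟩ := hasMellin_cothSqKernel h0 h1
  set G : ℝ → ℂ := fun t => (t : ℂ) ^ (-s - 1) * (cothSqKernel t : ℂ) with hG
  set F : ℕ → ℝ → ℂ := fun n t => ((n + 1 : ℝ) * π : ℝ) ^ (-s - 3) * G (((n + 1) * π)⁻¹ * t)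
    with hF
  have hGint : IntegrableOn G (Set.Ioi 0) := hconv
  have hGval : ∫ t in Set.Ioi 0, G t = (s + 1) * (π / Complex.sin (π * s / 2)) := hval
  have ha : ∀ n : ℕ, 0 < ((n + 1 : ℝ) * π) := fun n => by positivity
  have hFint : ∀ n, Integrable (F n) (volume.restrict (Set.Ioi 0)) := by
    intro n
    have := (integrableOn_Ioi_comp_mul_left_iff G 0 (inv_pos.2 (ha n))).2 (by simpa using hGint)
    exact this.const_mul _
  have hre : (-s - 3).re = -s.re - 3 := by simp
  have hFnorm : Summable fun n => ∫ t in Set.Ioi 0, ‖F n t‖ := by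
    have e : ∀ n, ∫ t in Set.Ioi 0, ‖F n t‖ =
        (1 / ((n + 1 : ℕ) : ℝ) ^ (s.re + 2)) *
          (π ^ (-s.re - 2) * ∫ t in Set.Ioi 0, ‖G t‖) := by
      intro n
      have h := integral_comp_mul_left_Ioi (fun t => ‖G t‖) 0 (inv_pos.2 (ha n))
      rw [mul_zero, inv_inv, smul_eq_mul] at h
      have hpow : ((n + 1 : ℝ) * π) ^ (-s.re - 2) =
          ((n + 1 : ℝ) * π) ^ (-s.re - 3) * ((n + 1 : ℝ) * π) := by
        rw [← Real.rpow_add_one (ha n).ne']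
        congr 1
        ring
      simp only [hF, norm_mul]
      rw [integral_const_mul, h, Complex.norm_cpow_eq_rpow_re_of_pos (ha n), hre, ← mul_assoc, ← hpow,
        Real.mul_rpow (by positivity) pi_pos.le, one_div, ← Real.rpow_neg (by positivity)]
      push_cast
      ring_nf
    simp only [e]
    exact ((summable_nat_add_iff 1).2
      (Real.summable_one_div_nat_rpow.2 (by linarith : 1 < s.re + 2))).mul_right _
  have hsum := (hasSum_integral_of_summable_integral_norm hFint hFnorm).tsum_eq
  have hπ : (π : ℂ) ≠ 0 := by exact_mod_cast pi_ne_zero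
  have hterm : ∀ n : ℕ, ∫ t in Set.Ioi 0, F n t =
      1 / ((n : ℂ) + 1) ^ (s + 2) *
        (π ^ (-s - 2) * ((s + 1) * (π / Complex.sin (π * s / 2)))) := by
    intro n
    have h := integral_comp_mul_left_Ioi G 0 (inv_pos.2 (ha n))
    have hac : (((n + 1 : ℝ) * π : ℝ) : ℂ) ≠ 0 := by exact_mod_cast (ha n).ne'
    rw [mul_zero, inv_inv, Complex.real_smul, hGval] at h
    have hpow : (((n + 1 : ℝ) * π : ℝ) : ℂ) ^ (-s - 2) =
        (((n + 1 : ℝ) * π : ℝ) : ℂ) ^ (-s - 3) * (((n + 1 : ℝ) * π : ℝ) : ℂ) := by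
      rw [show -s - 2 = (-s - 3) + 1 by ring, Complex.cpow_add _ _ hac, Complex.cpow_one]
    simp only [hF]
    rw [integral_const_mul, h, ← mul_assoc, ← hpow, Complex.ofReal_mul, Complex.mul_cpow_ofReal_nonneg (by positivity) pi_pos.le, one_div,
      ← Complex.cpow_neg]
    push_cast
    ring_nf
  have hpt : ∀ x ∈ Set.Ioi (0 : ℝ), ∑' n, F n x = (x : ℂ) ^ (-s - 1) *
      (((Real.cosh x / Real.sinh x) ^ 2 - 1 / x ^ 2 - 2 / 3 : ℝ) : ℂ) := by
    intro x hx
    have hx : 0 < x := hx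
    refine HasSum.tsum_eq ?_
    refine ((Complex.hasSum_ofReal.2 (hasSum_coth_sq hx)).mul_left _).congr_fun ?_
    intro n
    have hac : (((n + 1 : ℝ) * π : ℝ) : ℂ) ≠ 0 := by exact_mod_cast (ha n).ne'
    have hscale : (((((n + 1 : ℝ) * π)⁻¹ * x : ℝ)) : ℂ) ^ (-s - 1) =
        (((n + 1 : ℝ) * π : ℝ) : ℂ) ^ (s + 1) * (x : ℂ) ^ (-s - 1) := by
      rw [Complex.ofReal_mul, Complex.mul_cpow_ofReal_nonneg (inv_pos.2 (ha n)).le hx.le,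
        Complex.ofReal_inv, Complex.inv_cpow, ← Complex.cpow_neg]
      · congr 2
        ring
      · rw [Complex.arg_ofReal_of_nonneg (ha n).le]
        exact pi_pos.ne
    simp only [hF, hG]
    rw [hscale, ← mul_assoc, ← mul_assoc, ← Complex.cpow_add _ _ hac,
      show -s - 3 + (s + 1) = -2 by ring, Complex.cpow_neg, Complex.cpow_ofNat, Complex.ofReal_div,
      Complex.ofReal_pow]
    ring
  rw [setIntegral_congr_fun measurableSet_Ioi hpt] at hsum
  have hζ := zeta_eq_tsum_one_div_nat_add_one_cpow (s := s + 2) (by simp; linarith)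
  simp only [hterm] at hsum
  rw [tsum_mul_right, ← hζ] at hsum
  have hζ0 : riemannZeta (s + 2) ≠ 0 := riemannZeta_ne_zero_of_one_lt_re (by simp; linarith)
  have hs1 : s + 1 ≠ 0 := by
    intro h
    have := congrArg Complex.re h
    simp at this
    linarith
  have hsin : Complex.sin (π * s / 2) ≠ 0 := by
    rw [Complex.sin_ne_zero_iff]
    intro k hk
    have hk' : s = ((2 * k : ℤ) : ℂ) := by
      push_cast
      field_simp at hk
      linear_combination hk
    rw [hk', Complex.intCast_re] at h0 h1
    norm_cast at h0 h1
    omega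
  refine ⟨Integrable.of_integral_ne_zero ?_, ?_⟩
  · rw [← hsum]
    have : (π : ℂ) ^ (-s - 2) ≠ 0 := by simp [Complex.cpow_eq_zero_iff, hπ]
    positivity
  · rw [← hsum, show -s - 2 = -(s + 1) - 1 by ring, Complex.cpow_sub _ _ hπ, Complex.cpow_neg,
      Complex.cpow_one]
    have : (π : ℂ) ^ (s + 1) ≠ 0 := by simp [Complex.cpow_eq_zero_iff, hπ]
    generalize Complex.sin (π * s / 2) = S at hsin ⊢
    field_simp
end

section
/- For every real (or complex) x with 0 < |x| < π, coth²x = 1/x² + 2/3 + (2/π²) Σ_{n=1}^∞ (−1)^{n+1} (2n+1) ζ(2n+2) (x/π)^{2n}, the series converging absolutely. -/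
open Real

namespace Complex

lemma hasDerivAt_pi_mul_cot_pi_mul {z : ℂ} (hsin : sin (π * z) ≠ 0) :
    HasDerivAt (fun w : ℂ ↦ π * cot (π * w)) (-(π ^ 2 * (1 + cot (π * z) ^ 2))) z := by
  have hlin : HasDerivAt (fun w : ℂ ↦ (π : ℂ) * w) π z := by
    simpa using (hasDerivAt_id z).const_mul (π : ℂ)
  refine ((hlin.ccos.fun_div hlin.csin hsin).const_mul (π : ℂ)).congr_deriv ?_
  simp only [cot]
  field_simp
  ring

/-- `1 + cot² (π z)` as a sum of inverse squares over the lattice points. -/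
lemma pi_sq_mul_one_add_cot_sq {z : ℂ} (hz : 0 < z.im) :
    (π : ℂ) ^ 2 * (1 + cot (π * z) ^ 2) =
      1 / z ^ 2 + ∑' n : ℕ, (1 / (z + (n + 1)) ^ 2 + 1 / (z - (n + 1)) ^ 2) := by
  have hmem : z ∈ UpperHalfPlane.upperHalfPlaneSet := hz
  have hderiv := hasDerivAt_pi_mul_cot_pi_mul
    (sin_pi_mul_ne_zero (UpperHalfPlane.coe_mem_integerComplement ⟨z, hz⟩))
  have h := iteratedDerivWithin_cot_pi_mul_eq_mul_tsum_div_pow le_rfl hmem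
  rw [iteratedDerivWithin_one, hderiv.hasDerivWithinAt.derivWithin
    (UpperHalfPlane.isOpen_upperHalfPlaneSet.uniqueDiffWithinAt hmem)] at h
  have hsum : Summable fun n : ℤ ↦ 1 / (z + n) ^ 2 := by
    refine (EisensteinSeries.linear_right_summable z 1 (k := 2) le_rfl).congr fun n ↦ ?_
    rw [Int.cast_one, one_mul, one_div]
    norm_cast
  have hpos : Summable fun n : ℕ ↦ 1 / (z + ((n + 1 : ℤ) : ℂ)) ^ 2 :=
    hsum.comp_injective (i := fun n : ℕ ↦ (n + 1 : ℤ)) fun a b hab ↦ by simpa using hab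
  have hneg : Summable fun n : ℕ ↦ 1 / (z + ((-(n + 1) : ℤ) : ℂ)) ^ 2 :=
    hsum.comp_injective (i := fun n : ℕ ↦ (-(n + 1) : ℤ)) fun a b hab ↦ by simpa using hab
  have hsplit := tsum_of_add_one_of_neg_add_one (f := fun n : ℤ ↦ 1 / (z + n) ^ 2) hpos hneg
  have hadd := hpos.tsum_add hneg
  push_cast at hsplit hadd
  simp only [sub_eq_add_neg, neg_add] at hadd hsplit ⊢
  rw [hadd]
  norm_num at h hsplit ⊢
  linear_combination h + hsplit

/-- The expansion of `1 / (z + a)² + 1 / (z - a)²` in powers of `z`. -/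
lemma hasSum_one_div_add_sq_add_one_div_sub_sq {z a : ℂ} (h : ‖z‖ < ‖a‖) :
    HasSum (fun k : ℕ ↦ 2 * (2 * (k : ℂ) + 1) * z ^ (2 * k) * (1 / a ^ (2 * k + 2)))
      (1 / (z + a) ^ 2 + 1 / (z - a) ^ 2) := by
  have ha : a ≠ 0 := by rintro rfl; simp at h; linarith [norm_nonneg z]
  have hadd : z + a ≠ 0 := fun h0 ↦ by
    rw [eq_neg_of_add_eq_zero_left h0, norm_neg] at h; exact h.false
  have hsub : z - a ≠ 0 := fun h0 ↦ by rw [sub_eq_zero.mp h0] at h; exact h.false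
  have hu : ‖z ^ 2 / a ^ 2‖ < 1 := by
    rw [← div_pow, norm_pow, norm_div]
    exact pow_lt_one₀ (by positivity) ((div_lt_one (norm_pos_iff.mpr ha)).mpr h) two_ne_zero
  convert! (((hasSum_coe_mul_geometric_of_norm_lt_one hu).mul_left 2).add
    (hasSum_geometric_of_norm_lt_one hu)).mul_left (2 / a ^ 2) using 1
  · ext k
    rw [div_pow, ← pow_mul, ← pow_mul, pow_add]
    field_simp
  · have h1 : 1 - z ^ 2 / a ^ 2 = (a ^ 2 - z ^ 2) / a ^ 2 := by field_simp
    rw [h1]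
    field_simp
    rw [show a ^ 2 - z ^ 2 = -((z + a) * (z - a)) by ring]
    field_simp
    ring

lemma summable_two_mul_add_one_mul_pow {r : ℝ} (hr0 : 0 ≤ r) (hr : r < 1) :
    Summable fun k : ℕ ↦ 2 * (2 * (k : ℝ) + 1) * r ^ (2 * k) := by
  have hu : ‖r ^ 2‖ < 1 := by
    rw [norm_pow, Real.norm_of_nonneg hr0]
    exact pow_lt_one₀ hr0 hr two_ne_zero
  convert! (((hasSum_coe_mul_geometric_of_norm_lt_one hu).summable.mul_left 2).add
    (summable_geometric_of_norm_lt_one hu)).mul_left 2 using 2 with k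
  rw [← pow_mul]
  ring

lemma summable_uncurry_laurent_terms {z : ℂ} (hz : ‖z‖ < 1) :
    Summable (Function.uncurry fun k n : ℕ ↦
      2 * (2 * (k : ℂ) + 1) * z ^ (2 * k) * (1 / ((n : ℂ) + 1) ^ (2 * k + 2))) := by
  have hsq : Summable fun n : ℕ ↦ 1 / ((n : ℝ) + 1) ^ 2 := by
    simpa using (summable_nat_add_iff 1).mpr (Real.summable_one_div_nat_pow.mpr one_lt_two)
  refine .of_norm_bounded ((summable_two_mul_add_one_mul_pow (norm_nonneg z) hz).mul_of_nonneg hsq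
    (fun k ↦ by positivity) fun n ↦ by positivity) ?_
  rintro ⟨k, n⟩
  have hn : ‖(n : ℂ) + 1‖ = n + 1 := by exact_mod_cast norm_natCast (n + 1)
  have hk : ‖2 * (k : ℂ) + 1‖ = 2 * k + 1 := by exact_mod_cast norm_natCast (2 * k + 1)
  simp only [Function.uncurry_apply_pair, norm_mul, norm_pow, norm_div, hn, hk, norm_one,
    norm_ofNat]
  gcongr
  · linarith [n.cast_nonneg (α := ℝ)]
  · lia

lemma tsum_one_div_nat_add_one_pow {k : ℕ} (hk : 1 < k) :
    ∑' n : ℕ, 1 / ((n : ℂ) + 1) ^ k = riemannZeta k := by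
  have hs : Summable fun n : ℕ ↦ 1 / (n : ℂ) ^ k := by
    refine (summable_ofReal.mpr (Real.summable_one_div_nat_pow.mpr hk)).congr fun n ↦ ?_
    push_cast
    rfl
  rw [zeta_nat_eq_tsum_of_gt_one hk, hs.tsum_eq_zero_add]
  simp [show k ≠ 0 by lia]

lemma tsum_laurent_terms (z : ℂ) (k : ℕ) :
    ∑' n : ℕ, 2 * (2 * (k : ℂ) + 1) * z ^ (2 * k) * (1 / ((n : ℂ) + 1) ^ (2 * k + 2)) =
      2 * (2 * (k : ℂ) + 1) * z ^ (2 * k) * riemannZeta (2 * k + 2) := by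
  rw [tsum_mul_left, tsum_one_div_nat_add_one_pow (by lia)]
  push_cast
  rfl

lemma summable_mul_pow_mul_riemannZeta {z : ℂ} (hz : ‖z‖ < 1) :
    Summable fun k : ℕ ↦ 2 * (2 * (k : ℂ) + 1) * z ^ (2 * k) * riemannZeta (2 * k + 2) := by
  simpa only [Function.uncurry_apply_pair, tsum_laurent_terms] using
    (summable_uncurry_laurent_terms hz).prod

lemma tsum_one_div_add_sq_add_one_div_sub_sq {z : ℂ} (hz : ‖z‖ < 1) :
    ∑' n : ℕ, (1 / (z + (n + 1)) ^ 2 + 1 / (z - (n + 1)) ^ 2) =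
      ∑' k : ℕ, 2 * (2 * (k : ℂ) + 1) * z ^ (2 * k) * riemannZeta (2 * k + 2) := by
  simp_rw [← tsum_laurent_terms]
  rw [← (summable_uncurry_laurent_terms hz).tsum_comm]
  refine tsum_congr fun n ↦ (hasSum_one_div_add_sq_add_one_div_sub_sq ?_).tsum_eq.symm
  have hn : ‖(n : ℂ) + 1‖ = n + 1 := by exact_mod_cast norm_natCast (n + 1)
  rw [hn]
  linarith [n.cast_nonneg (α := ℝ)]

lemma I_mul_ofReal_pow_two_mul (t : ℝ) (k : ℕ) :
    (I * (t : ℂ)) ^ (2 * k) = (-1) ^ k * ((t ^ (2 * k) : ℝ) : ℂ) := by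
  rw [mul_pow, pow_mul I, I_sq, ofReal_pow]

lemma cot_I_mul_sq (x : ℂ) : cot (I * x) ^ 2 = -(cosh x / sinh x) ^ 2 := by
  rw [cot, mul_comm I, cos_mul_I, sin_mul_I, div_pow, mul_pow, I_sq, div_pow, mul_neg_one, div_neg]

end Complex

open Complex in
lemma coth_sq_laurent_series_of_pos {x : ℝ} (hx0 : 0 < x) (hx : x < π) :
    Summable (fun m : ℕ => (-1 : ℂ) ^ m * (2 * (m : ℂ) + 3) * riemannZeta (2 * (m : ℂ) + 4) *
      (((x / π) ^ (2 * m + 2) : ℝ) : ℂ)) ∧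
    (((Real.cosh x / Real.sinh x) ^ 2 : ℝ) : ℂ) =
      1 / (x : ℂ) ^ 2 + 2 / 3 + (2 / (π : ℂ) ^ 2) *
      ∑' m : ℕ, (-1 : ℂ) ^ m * (2 * (m : ℂ) + 3) * riemannZeta (2 * (m : ℂ) + 4) *
        (((x / π) ^ (2 * m + 2) : ℝ) : ℂ) := by
  have hπ : (π : ℂ) ≠ 0 := ofReal_ne_zero.mpr pi_ne_zero
  have hxC : (x : ℂ) ≠ 0 := ofReal_ne_zero.mpr hx0.ne'
  have ht : 0 < x / π := by positivity
  set z : ℂ := I * ((x / π : ℝ) : ℂ) with hzdef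
  have hz : ‖z‖ < 1 := by
    rw [hzdef, norm_mul, norm_I, one_mul, norm_real, Real.norm_of_nonneg ht.le]
    exact (div_lt_one pi_pos).mpr hx
  have him : 0 < z.im := by simpa [hzdef, -ofReal_div] using ht
  have hs := summable_mul_pow_mul_riemannZeta hz
  have hterm (m : ℕ) : 2 * (2 * ((m + 1 : ℕ) : ℂ) + 1) * z ^ (2 * (m + 1)) *
      riemannZeta (2 * (m + 1 : ℕ) + 2) = -2 * ((-1 : ℂ) ^ m * (2 * (m : ℂ) + 3) *
        riemannZeta (2 * (m : ℂ) + 4) * (((x / π) ^ (2 * m + 2) : ℝ) : ℂ)) := by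
    rw [hzdef, I_mul_ofReal_pow_two_mul, show 2 * ((m + 1 : ℕ) : ℂ) + 2 = 2 * m + 4 by
      push_cast; ring, show 2 * (m + 1) = 2 * m + 2 by ring]
    push_cast
    ring
  refine ⟨?_, ?_⟩
  · have := (summable_nat_add_iff 1).mpr hs
    simp_rw [hterm] at this
    exact (summable_mul_left_iff (by norm_num)).mp this
  · have h := pi_sq_mul_one_add_cot_sq him
    rw [tsum_one_div_add_sq_add_one_div_sub_sq hz, hs.tsum_eq_zero_add] at h
    simp_rw [hterm] at h
    rw [tsum_mul_left, show (π : ℂ) * z = I * x by rw [hzdef]; push_cast; field_simp,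
      cot_I_mul_sq] at h
    have hz2 : z ^ 2 = -(x ^ 2 / π ^ 2) := by
      rw [hzdef, mul_pow, I_sq]; push_cast; ring
    simp only [hz2, Nat.cast_zero, mul_zero, zero_add, pow_zero, mul_one, riemannZeta_two] at h
    rw [ofReal_pow, ofReal_div, ofReal_cosh, ofReal_sinh]
    generalize (∑' m : ℕ, (-1 : ℂ) ^ m * (2 * (m : ℂ) + 3) * riemannZeta (2 * (m : ℂ) + 4) *
        (((x / π) ^ (2 * m + 2) : ℝ) : ℂ)) = S at h ⊢
    generalize (Complex.cosh (x : ℂ) / Complex.sinh x) ^ 2 = c at h ⊢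
    field_simp at h ⊢
    linear_combination (-1 / 2) * h

/-- For real `x` with `0 < |x| < π`,
`coth² x = 1/x² + 2/3 + (2/π²) ∑_{n=1}^∞ (-1)^(n+1) (2n+1) ζ(2n+2) (x/π)^(2n)`,
the series converging absolutely (indexed here by `n = m + 1`, `m : ℕ`). -/
theorem coth_sq_laurent_series (x : ℝ) (hx0 : 0 < |x|) (hx : |x| < π) :
    Summable (fun m : ℕ => ‖(-1 : ℂ) ^ m * (2 * (m : ℂ) + 3) * riemannZeta (2 * (m : ℂ) + 4) *
      (((x / π) ^ (2 * m + 2) : ℝ) : ℂ)‖) ∧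
    (((Real.cosh x / Real.sinh x) ^ 2 : ℝ) : ℂ) =
      1 / (x : ℂ) ^ 2 + 2 / 3 + (2 / (π : ℂ) ^ 2) *
      ∑' m : ℕ, (-1 : ℂ) ^ m * (2 * (m : ℂ) + 3) * riemannZeta (2 * (m : ℂ) + 4) *
        (((x / π) ^ (2 * m + 2) : ℝ) : ℂ) := by
  have heven (m : ℕ) : (|x| / π) ^ (2 * m + 2) = (x / π) ^ (2 * m + 2) := by
    rw [show 2 * m + 2 = 2 * (m + 1) by ring, pow_mul, pow_mul, div_pow, sq_abs, ← div_pow]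
  have hcoth : (Real.cosh |x| / Real.sinh |x|) ^ 2 = (Real.cosh x / Real.sinh x) ^ 2 := by
    rcases abs_choice x with h | h <;> simp [h, div_pow]
  have hsq : ((|x| : ℝ) : ℂ) ^ 2 = (x : ℂ) ^ 2 := by exact_mod_cast sq_abs x
  have h := coth_sq_laurent_series_of_pos hx0 hx
  simp only [heven, hcoth, hsq] at h
  exact ⟨h.1.norm, h.2⟩
end

section
/- For every real (or complex) x with |x| < π/2, 1/cosh²x = 1 + (2/π²) Σ_{n=1}^∞ (−1)^n (2n+1)(2^{2n+2} − 1) ζ(2n+2) (x/π)^{2n}, the series converging absolutely. -/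
open Real

/-- The Mittag-Leffler expansion of `π² / sin² (π z)` on the upper half plane. -/
theorem tsum_one_div_add_int_sq {z : ℂ} (hz : 0 < z.im) :
    ∑' n : ℤ, 1 / (z + n) ^ 2 = (π : ℂ) ^ 2 / Complex.sin (π * z) ^ 2 := by
  have hopen := UpperHalfPlane.isOpen_upperHalfPlaneSet
  have hsin : Complex.sin (π * z) ≠ 0 := by
    rw [Ne, Complex.sin_eq_zero_iff]
    rintro ⟨k, hk⟩
    have him := congrArg Complex.im hk
    simp [hz.ne', Real.pi_ne_zero] at him
  have hlin : HasDerivAt (fun w : ℂ => (π : ℂ) * w) π z := by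
    simpa using (hasDerivAt_id z).const_mul (π : ℂ)
  have hcot : HasDerivAt (fun w : ℂ => (π : ℂ) * Complex.cot (π * w))
      (-((π : ℂ) ^ 2 / Complex.sin (π * z) ^ 2)) z := by
    have hd := ((hlin.ccos.div hlin.csin hsin).const_mul (π : ℂ))
    convert! hd using 1
    field_simp
    linear_combination (Complex.sin_sq_add_cos_sq (π * z))
  have hseries := iteratedDerivWithin_cot_pi_mul_eq_mul_tsum_div_pow (k := 1) le_rfl
    (z := z) hz
  rw [iteratedDerivWithin_one, derivWithin_of_isOpen hopen hz, hcot.deriv] at hseries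
  norm_num at hseries ⊢
  exact hseries.symm

theorem summable_one_div_nat_add_half_pow {k : ℕ} (hk : 1 < k) :
    Summable fun n : ℕ => 1 / ((n : ℝ) + 1 / 2) ^ k := by
  have h := (Real.summable_one_div_nat_add_rpow (1 / 2) k).2 (by exact_mod_cast hk)
  refine h.congr fun n => ?_
  rw [Real.rpow_natCast, abs_of_pos (by positivity)]

/-- The sum of the `k`-th inverse powers of the positive half-integers. -/
theorem tsum_one_div_nat_add_half_pow {k : ℕ} (hk : 1 < k) :
    ∑' n : ℕ, 1 / ((n : ℂ) + 1 / 2) ^ k = ((2 : ℂ) ^ k - 1) * riemannZeta k := by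
  have hs : Summable fun n : ℕ => 1 / (n : ℂ) ^ k := by
    have h := (Real.summable_one_div_nat_pow (p := k)).2 hk
    rw [← Complex.summable_ofReal] at h
    simpa using h
  have heven : ∀ n : ℕ, 1 / ((2 * n : ℕ) : ℂ) ^ k = (1 / 2 ^ k) * (1 / (n : ℂ) ^ k) := by
    intro n
    push_cast
    rw [mul_pow, one_div_mul_one_div]
  have hodd : ∀ n : ℕ, 1 / ((2 * n + 1 : ℕ) : ℂ) ^ k
      = (1 / 2 ^ k) * (1 / ((n : ℂ) + 1 / 2) ^ k) := by
    intro n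
    push_cast
    rw [one_div_mul_one_div, ← mul_pow]
    congr 2
    ring
  have hs₀ : Summable fun n : ℕ => 1 / ((2 * n : ℕ) : ℂ) ^ k :=
    hs.comp_injective (i := fun n => 2 * n) fun m n hmn => by simpa using hmn
  have hs₁ : Summable fun n : ℕ => 1 / ((2 * n + 1 : ℕ) : ℂ) ^ k :=
    hs.comp_injective (i := fun n => 2 * n + 1) fun m n hmn => by simpa using hmn
  have h := tsum_even_add_odd (f := fun n : ℕ => 1 / (n : ℂ) ^ k) hs₀ hs₁
  rw [← zeta_nat_eq_tsum_of_gt_one hk, tsum_congr heven, tsum_congr hodd, tsum_mul_left,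
    tsum_mul_left, ← zeta_nat_eq_tsum_of_gt_one hk] at h
  have h2 : (2 : ℂ) ^ k ≠ 0 := pow_ne_zero k two_ne_zero
  generalize ∑' n : ℕ, 1 / ((n : ℂ) + 1 / 2) ^ k = s at h ⊢
  field_simp at h ⊢
  linear_combination h

/-- The Mittag-Leffler expansion of `π² / cosh² (π y)`. -/
theorem tsum_half_integer_eq_sech_sq {y : ℝ} (hy : 0 < y) :
    ∑' n : ℕ, 2 * ((((n : ℝ) + 1 / 2) ^ 2 - y ^ 2) / (((n : ℝ) + 1 / 2) ^ 2 + y ^ 2) ^ 2)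
      = π ^ 2 / Real.cosh (π * y) ^ 2 := by
  have hz := tsum_one_div_add_int_sq (z := 1 / 2 + y * Complex.I) (by simpa using hy)
  have hsin : Complex.sin (π * (1 / 2 + y * Complex.I)) = Complex.cosh (π * y) := by
    rw [show (π : ℂ) * (1 / 2 + y * Complex.I) = (π * y) * Complex.I + π / 2 by ring,
      Complex.sin_add_pi_div_two, Complex.cos_mul_I]
  have hbound := summable_one_div_nat_add_half_pow one_lt_two
  have hpos : Summable fun n : ℕ => 1 / ((1 / 2 + y * Complex.I : ℂ) + ((n : ℤ) : ℂ)) ^ 2 := by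
    refine hbound.of_norm_bounded fun n => ?_
    rw [norm_div, norm_one, norm_pow]
    gcongr
    refine le_trans (le_abs_self _) (le_trans (le_of_eq ?_) (Complex.abs_re_le_norm _))
    simp [add_comm]
  have hneg : Summable fun n : ℕ =>
      1 / ((1 / 2 + y * Complex.I : ℂ) + ((-(n + 1) : ℤ) : ℂ)) ^ 2 := by
    refine hbound.of_norm_bounded fun n => ?_
    rw [norm_div, norm_one, norm_pow]
    gcongr
    refine le_trans (neg_le_abs (-((n : ℝ) + 1 / 2)) |>.trans_eq' (by ring))
      (le_trans (le_of_eq ?_) (Complex.abs_re_le_norm _))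
    congr 1
    simp
    ring
  rw [tsum_of_nat_of_neg_add_one (f := fun n : ℤ => 1 / ((1 / 2 + y * Complex.I : ℂ) + n) ^ 2)
    hpos hneg, ← hpos.tsum_add hneg, hsin] at hz
  apply Complex.ofReal_injective
  push_cast
  rw [← hz]
  refine tsum_congr fun n => ?_
  have hne : ((n : ℂ) + 1 / 2) + y * Complex.I ≠ 0 := fun h => by
    have := congrArg Complex.im h
    simp [hy.ne'] at this
  have hne' : ((n : ℂ) + 1 / 2) - y * Complex.I ≠ 0 := fun h => by
    have := congrArg Complex.im h
    simp [hy.ne'] at this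
  push_cast
  have hfac : ((n : ℂ) + 1 / 2) ^ 2 + (y : ℂ) ^ 2
      = (((n : ℂ) + 1 / 2) + y * Complex.I) * (((n : ℂ) + 1 / 2) - y * Complex.I) := by
    linear_combination (y : ℂ) ^ 2 * Complex.I_sq
  rw [hfac, show (1 / 2 + y * Complex.I + n : ℂ) = ((n : ℂ) + 1 / 2) + y * Complex.I by ring,
    show (1 / 2 + y * Complex.I + -(n + 1) : ℂ) = -(((n : ℂ) + 1 / 2) - y * Complex.I) by ring,
    neg_sq]
  rw [div_add_div _ _ (pow_ne_zero 2 hne) (pow_ne_zero 2 hne'), mul_pow, mul_div_assoc']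
  congr 1
  linear_combination (-2 * (y : ℂ) ^ 2) * Complex.I_sq

theorem hasSum_odd_mul_geometric {r : ℝ} (hr : |r| < 1) :
    HasSum (fun k : ℕ => (2 * (k : ℝ) + 1) * r ^ k) ((1 + r) / (1 - r) ^ 2) := by
  have h := ((hasSum_coe_mul_geometric_of_norm_lt_one (r := r) hr).mul_left 2).add
    (hasSum_geometric_of_norm_lt_one (ξ := r) hr)
  have hne : 1 - r ≠ 0 := by linarith [(abs_lt.1 hr).2]
  convert! h using 1
  · ext k; ring
  · field_simp; ring

theorem hasSum_taylor_half_integer {a y : ℝ} (h : |y| < a) :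
    HasSum (fun k : ℕ => (-1) ^ k * (2 * (k : ℝ) + 1) * y ^ (2 * k) * (1 / a ^ (2 * k + 2)))
      ((a ^ 2 - y ^ 2) / (a ^ 2 + y ^ 2) ^ 2) := by
  have ha : 0 < a := (abs_nonneg y).trans_lt h
  have hr : |-(y / a) ^ 2| < 1 := by
    rw [abs_neg, abs_pow, abs_div, abs_of_pos ha, sq_lt_one_iff₀ (by positivity)]
    exact (div_lt_one ha).2 h
  have hs := (hasSum_odd_mul_geometric hr).mul_left (1 / a ^ 2)
  convert! hs using 1
  · ext k
    rw [neg_pow ((y / a) ^ 2), ← pow_mul, div_pow, pow_add]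
    field_simp
  · have : a ^ 2 + y ^ 2 ≠ 0 := by positivity
    have h1 : 1 - -(y / a) ^ 2 = (a ^ 2 + y ^ 2) / a ^ 2 := by field_simp; ring
    rw [h1]
    field_simp
    ring

theorem summable_taylor_half_integer {y : ℝ} (hy : |y| < 1 / 2) :
    Summable fun p : ℕ × ℕ => (-1) ^ p.1 * (2 * (p.1 : ℝ) + 1) * y ^ (2 * p.1) *
      (1 / ((p.2 : ℝ) + 1 / 2) ^ (2 * p.1 + 2)) := by
  have hr : |(2 * y) ^ 2| < 1 := by
    rw [abs_pow, abs_mul, abs_two, sq_lt_one_iff₀ (by positivity)]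
    linarith
  refine ((hasSum_odd_mul_geometric hr).summable.mul_of_nonneg
    (summable_one_div_nat_add_half_pow one_lt_two) (fun k => by dsimp; positivity)
    (fun n => by dsimp; positivity)).of_norm_bounded fun ⟨k, n⟩ => ?_
  have hle : 1 / ((n : ℝ) + 1 / 2) ^ (2 * k) ≤ 2 ^ (2 * k) := by
    rw [div_le_iff₀ (by positivity), ← mul_pow]
    apply one_le_pow₀
    have : (0 : ℝ) ≤ n := n.cast_nonneg
    linarith
  have habs : |y| ^ (2 * k) = y ^ (2 * k) := by rw [pow_mul, pow_mul, sq_abs]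
  have hodd : |2 * (k : ℝ) + 1| = 2 * k + 1 := abs_of_pos (by positivity)
  have hpos : |(n : ℝ) + 1 / 2| = n + 1 / 2 := abs_of_pos (by positivity)
  have hy0 : 0 ≤ y ^ (2 * k) := habs ▸ by positivity
  simp only [Real.norm_eq_abs, abs_mul, abs_pow, abs_neg, abs_one, one_pow, one_mul, abs_div,
    habs, hodd, hpos]
  rw [pow_add, ← one_div_mul_one_div, ← pow_mul, mul_pow]
  calc _ = (2 * (k : ℝ) + 1) * y ^ (2 * k) * (1 / ((n : ℝ) + 1 / 2) ^ 2) *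
        (1 / ((n : ℝ) + 1 / 2) ^ (2 * k)) := by ring
    _ ≤ (2 * (k : ℝ) + 1) * y ^ (2 * k) * (1 / ((n : ℝ) + 1 / 2) ^ 2) * 2 ^ (2 * k) := by
        gcongr
    _ = _ := by ring

/-- The power series of `π² / cosh² (π y)` in terms of sums over half-integers. -/
theorem hasSum_sech_sq {y : ℝ} (hy0 : 0 < y) (hy : |y| < 1 / 2) :
    HasSum (fun k : ℕ => (-1) ^ k * (2 * (k : ℝ) + 1) * y ^ (2 * k) *
      ∑' n : ℕ, 1 / ((n : ℝ) + 1 / 2) ^ (2 * k + 2)) (π ^ 2 / Real.cosh (π * y) ^ 2 / 2) := by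
  have hs := summable_taylor_half_integer hy
  have hrow := hs.hasSum.prod_fiberwise fun k => (hs.prod_factor k).hasSum
  simp only [tsum_mul_left] at hrow
  convert! hrow using 1
  rw [← (Equiv.prodComm ℕ ℕ).tsum_eq, Equiv.coe_prodComm, hs.prod_symm.tsum_prod, ← tsum_half_integer_eq_sech_sq hy0, tsum_mul_left,
    mul_div_cancel_left₀ _ two_ne_zero]
  refine tsum_congr fun n => (hasSum_taylor_half_integer ?_).tsum_eq.symm
  exact hy.trans_le (le_add_of_nonneg_left n.cast_nonneg)

/-- The power series of `1 / cosh² x` for `0 < x < π / 2`, constant term included. -/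
theorem hasSum_sech_sq_zeta {x : ℝ} (hx0 : 0 < x) (hx : x < π / 2) :
    HasSum (fun k : ℕ => (-1 : ℂ) ^ k * (2 * (k : ℂ) + 1) * ((2 : ℂ) ^ (2 * k + 2) - 1) *
      riemannZeta (2 * (k : ℂ) + 2) * (((x / π) ^ (2 * k) : ℝ) : ℂ))
      (((π ^ 2 / Real.cosh x ^ 2 / 2 : ℝ) : ℂ)) := by
  have hy0 : 0 < x / π := by positivity
  have hy : |x / π| < 1 / 2 := by
    rw [abs_of_pos hy0, div_lt_iff₀ Real.pi_pos]
    linarith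
  have h := hasSum_sech_sq hy0 hy
  rw [mul_div_cancel₀ _ Real.pi_ne_zero, ← Complex.hasSum_ofReal] at h
  convert! h using 1
  ext k
  have hz := tsum_one_div_nat_add_half_pow (k := 2 * k + 2) (by lia)
  push_cast at hz ⊢
  rw [hz]
  ring

/-- For real `x` with `|x| < π/2`,
`1/cosh² x = 1 + (2/π²) ∑_{n=1}^∞ (-1)^n (2n+1)(2^(2n+2) - 1) ζ(2n+2) (x/π)^(2n)`,
the series converging absolutely (indexed here by `n = m + 1`, `m : ℕ`). -/
theorem sech_sq_taylor_series (x : ℝ) (hx : |x| < π / 2) :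
    Summable (fun m : ℕ => ‖(-1 : ℂ) ^ (m + 1) * (2 * (m : ℂ) + 3) *
      ((2 : ℂ) ^ (2 * m + 4) - 1) * riemannZeta (2 * (m : ℂ) + 4) *
      (((x / π) ^ (2 * m + 2) : ℝ) : ℂ)‖) ∧
    ((1 / (Real.cosh x) ^ 2 : ℝ) : ℂ) = 1 + (2 / (π : ℂ) ^ 2) *
      ∑' m : ℕ, (-1 : ℂ) ^ (m + 1) * (2 * (m : ℂ) + 3) *
        ((2 : ℂ) ^ (2 * m + 4) - 1) * riemannZeta (2 * (m : ℂ) + 4) *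
        (((x / π) ^ (2 * m + 2) : ℝ) : ℂ) := by
  have heven : ∀ m : ℕ, (x / π) ^ (2 * m + 2) = (|x| / π) ^ (2 * m + 2) := fun m => by
    rw [show 2 * m + 2 = 2 * (m + 1) by ring, pow_mul, pow_mul, div_pow x, div_pow |x|, sq_abs]
  simp only [heven]
  rw [← Real.cosh_abs x]
  rcases (abs_nonneg x).eq_or_lt with h0 | h0
  · simp [← h0]
  have h := hasSum_sech_sq_zeta h0 hx
  rw [← hasSum_nat_add_iff' 1] at h
  have hterm : (fun m : ℕ => (-1 : ℂ) ^ (m + 1) * (2 * (m : ℂ) + 3) *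
      ((2 : ℂ) ^ (2 * m + 4) - 1) * riemannZeta (2 * (m : ℂ) + 4) *
      (((|x| / π) ^ (2 * m + 2) : ℝ) : ℂ)) = fun m : ℕ => (-1 : ℂ) ^ (m + 1) *
      (2 * ((m + 1 : ℕ) : ℂ) + 1) * ((2 : ℂ) ^ (2 * (m + 1) + 2) - 1) *
      riemannZeta (2 * ((m + 1 : ℕ) : ℂ) + 2) *
      (((|x| / π) ^ (2 * (m + 1)) : ℝ) : ℂ) := by
    ext m
    push_cast
    ring_nf
  rw [hterm, h.tsum_eq]
  refine ⟨(h.summable.congr fun m => (congrFun hterm m).symm).norm.congr fun m => ?_, ?_⟩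
  · rw [congrFun hterm m]
  · have hpi : (π : ℂ) ≠ 0 := by exact_mod_cast Real.pi_ne_zero
    have hcosh : Complex.cosh (|x| : ℝ) ≠ 0 := by
      exact_mod_cast (Real.cosh_pos |x|).ne'
    simp [riemannZeta_two]
    field_simp
    ring
end

section
/- For every real (or complex) x with 0 < |x| < π, coth³x = 1/x³ + 1/x + (2/π) Σ_{n=0}^∞ (−1)^{n+1} [ (1/π²)(n+1)(2n+3)ζ(2n+4) − ζ(2n+2) ] (x/π)^{2n+1}, the series converging absolutely. -/
open Real

/-- The value of the Riemann zeta function at `k ≥ 2`, as a real series. -/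
noncomputable def realZeta (k : ℕ) : ℝ := ∑' m : ℕ, 1 / ((m : ℝ) + 1) ^ k

lemma summable_one_div_nat_add_one_pow {k : ℕ} (hk : 2 ≤ k) :
    Summable fun m : ℕ => 1 / ((m : ℝ) + 1) ^ k := by
  have h := (summable_nat_add_iff 1).2 (Real.summable_one_div_nat_pow.2 (show 1 < k by omega))
  simpa using h

lemma realZeta_nonneg (k : ℕ) : 0 ≤ realZeta k :=
  tsum_nonneg fun m => by positivity

lemma realZeta_le {k : ℕ} (hk : 2 ≤ k) : realZeta k ≤ realZeta 2 := by
  refine (summable_one_div_nat_add_one_pow hk).tsum_le_tsum (fun m => ?_)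
    (summable_one_div_nat_add_one_pow le_rfl)
  have h1 : (1 : ℝ) ≤ (m : ℝ) + 1 := by linarith [Nat.cast_nonneg (α := ℝ) m]
  gcongr

lemma riemannZeta_eq_realZeta {k : ℕ} (hk : 2 ≤ k) : riemannZeta (k : ℂ) = (realZeta k : ℂ) := by
  rw [zeta_eq_tsum_one_div_nat_add_one_cpow (by simpa using (show 1 < k by omega)), realZeta,
    Complex.ofReal_tsum]
  refine tsum_congr fun m => ?_
  rw [Complex.cpow_natCast]
  push_cast
  rfl

lemma summable_succ_pow_mul_geometric (k : ℕ) {r : ℝ} (h0 : 0 < r) (h1 : r < 1) :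
    Summable fun n : ℕ => ((n : ℝ) + 1) ^ k * r ^ n := by
  have hr : ‖r‖ < 1 := by rwa [Real.norm_of_nonneg h0.le]
  have h : Summable fun n : ℕ => ((n + 1 : ℕ) : ℝ) ^ k * r ^ (n + 1) :=
    (summable_nat_add_iff (f := fun n : ℕ => (n : ℝ) ^ k * r ^ n) 1).2
      (summable_pow_mul_geometric_of_norm_lt_one k hr)
  refine (h.mul_left r⁻¹).congr fun n => ?_
  rw [Nat.cast_add_one, pow_succ r]
  field_simp

section

variable {b : ℕ → ℝ} {e : ℕ → ℕ} {C : ℝ} {k : ℕ} {y : ℝ}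

lemma summable_norm_mul_pow (hb : ∀ n, |b n| ≤ C * ((n : ℝ) + 1) ^ k) (he : ∀ n, n ≤ e n + 1)
    (hy : |y| < 1) : Summable fun n => ‖b n * y ^ e n‖ := by
  obtain ⟨r, hyr, hr1⟩ := exists_between hy
  have hr0 : 0 < r := (abs_nonneg y).trans_lt hyr
  refine Summable.of_nonneg_of_le (fun n => norm_nonneg _) (fun n => ?_)
    ((summable_succ_pow_mul_geometric k hr0 hr1).mul_left (C * r⁻¹))
  have hpow : |y| ^ e n ≤ r⁻¹ * r ^ n := by
    rw [le_inv_mul_iff₀ hr0]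
    calc r * |y| ^ e n ≤ r * r ^ e n := by gcongr
      _ = r ^ (e n + 1) := by ring
      _ ≤ r ^ n := pow_le_pow_of_le_one hr0.le hr1.le (he n)
  rw [norm_mul, norm_pow, Real.norm_eq_abs, Real.norm_eq_abs]
  calc |b n| * |y| ^ e n ≤ (C * ((n : ℝ) + 1) ^ k) * (r⁻¹ * r ^ n) :=
        mul_le_mul (hb n) hpow (by positivity) ((abs_nonneg _).trans (hb n))
    _ = _ := by ring

lemma abs_mul_exponent_le (hb : ∀ n, |b n| ≤ C * ((n : ℝ) + 1) ^ k) (he : ∀ n, e n ≤ 2 * n + 1)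
    (n : ℕ) : |b n * e n| ≤ 2 * C * ((n : ℝ) + 1) ^ (k + 1) := by
  have h : (e n : ℝ) ≤ 2 * ((n : ℝ) + 1) := by
    have : (e n : ℝ) ≤ 2 * n + 1 := by exact_mod_cast he n
    linarith
  rw [abs_mul, Nat.abs_cast]
  calc |b n| * e n ≤ (C * ((n : ℝ) + 1) ^ k) * (2 * ((n : ℝ) + 1)) :=
        mul_le_mul (hb n) h (by positivity) ((abs_nonneg _).trans (hb n))
    _ = _ := by ring

lemma hasDerivAt_tsum_mul_pow (hb : ∀ n, |b n| ≤ C * ((n : ℝ) + 1) ^ k) (he : ∀ n, n ≤ e n)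
    (he' : ∀ n, e n ≤ 2 * n + 1) (hy : |y| < 1) :
    HasDerivAt (fun z => ∑' n, b n * z ^ e n) (∑' n, b n * e n * y ^ (e n - 1)) y := by
  obtain ⟨r, hyr, hr1⟩ := exists_between hy
  have hr0 : 0 < r := (abs_nonneg y).trans_lt hyr
  have hmem : y ∈ Metric.ball (0 : ℝ) r := by simpa using hyr
  refine hasDerivAt_tsum_of_isPreconnected (𝕜 := ℝ) (F := ℝ) (t := Metric.ball 0 r)
    (g := fun n z => b n * z ^ e n) (g' := fun n z => b n * e n * z ^ (e n - 1))
    (u := fun n => ‖b n * e n * r ^ (e n - 1)‖)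
    (summable_norm_mul_pow (abs_mul_exponent_le hb he') (fun n => ?_) ?_)
    Metric.isOpen_ball (convex_ball _ _).isPreconnected (fun n z _ => ?_) (fun n z hz => ?_) hmem
    ?_ hmem
  · have := he n
    omega
  · rwa [abs_of_pos hr0]
  · simpa [mul_assoc] using (hasDerivAt_pow (e n) z).const_mul (b n)
  · have hz' : ‖z‖ ≤ ‖r‖ := by
      rw [Real.norm_of_nonneg hr0.le]
      exact (mem_ball_zero_iff.1 hz).le
    rw [norm_mul, norm_mul (b n * e n), norm_pow, norm_pow]
    gcongr
  · exact (summable_norm_mul_pow hb (fun n => (he n).trans (Nat.le_succ _)) hy).of_norm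

end

/-- Coefficients of the odd power series `π * coth (π * y) - 1 / y`. -/
noncomputable def cothCoeff (n : ℕ) : ℝ := 2 * (-1) ^ n * realZeta (2 * n + 2)

lemma abs_cothCoeff_le (n : ℕ) : |cothCoeff n| ≤ 2 * realZeta 2 * ((n : ℝ) + 1) ^ 0 := by
  have h := realZeta_le (show 2 ≤ 2 * n + 2 by omega)
  rw [cothCoeff, abs_mul, abs_mul, abs_pow, abs_of_nonneg (realZeta_nonneg _)]
  simpa using h

lemma tsum_partial_fractions_eq {y : ℝ} (hy : |y| < 1) :
    ∑' m : ℕ, 2 * y / (y ^ 2 + ((m : ℝ) + 1) ^ 2) = ∑' n, cothCoeff n * y ^ (2 * n + 1) := by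
  have hy2 : y ^ 2 < 1 := (sq_lt_one_iff_abs_lt_one y).2 hy
  let f : ℕ → ℕ → ℝ := fun m n => 2 * (-1) ^ n * y ^ (2 * n + 1) * (1 / ((m : ℝ) + 1) ^ (2 * n + 2))
  have hs : Summable (Function.uncurry f) := by
    have hg := (summable_one_div_nat_add_one_pow le_rfl).mul_of_nonneg
      ((summable_geometric_of_lt_one (sq_nonneg y) hy2).mul_left 2)
      (fun m => by positivity) (fun n => by positivity)
    refine Summable.of_norm_bounded hg fun p => ?_
    obtain ⟨m, n⟩ := p
    have h1 : (1 : ℝ) ≤ (m : ℝ) + 1 := by linarith [Nat.cast_nonneg (α := ℝ) m]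
    have h2 : |y| ^ (2 * n + 1) ≤ (y ^ 2) ^ n := by
      rw [← sq_abs y, ← pow_mul]
      exact pow_le_pow_of_le_one (abs_nonneg _) hy.le (by omega)
    have h3 : 1 / ((m : ℝ) + 1) ^ (2 * n + 2) ≤ 1 / ((m : ℝ) + 1) ^ 2 := by
      have : ((m : ℝ) + 1) ^ 2 ≤ ((m : ℝ) + 1) ^ (2 * n + 2) := pow_le_pow_right₀ h1 (by omega)
      gcongr
    have h4 : ‖f m n‖ = 2 * |y| ^ (2 * n + 1) * (1 / ((m : ℝ) + 1) ^ (2 * n + 2)) := by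
      simp only [f, norm_mul, norm_pow, Real.norm_eq_abs]
      rw [abs_of_nonneg (show (0 : ℝ) ≤ 1 / ((m : ℝ) + 1) ^ (2 * n + 2) by positivity)]
      simp
    calc ‖f m n‖ = 2 * |y| ^ (2 * n + 1) * (1 / ((m : ℝ) + 1) ^ (2 * n + 2)) := h4
      _ ≤ 2 * (y ^ 2) ^ n * (1 / ((m : ℝ) + 1) ^ 2) := by gcongr
      _ = _ := by ring
  calc ∑' m : ℕ, 2 * y / (y ^ 2 + ((m : ℝ) + 1) ^ 2) = ∑' m, ∑' n, f m n := by
        refine tsum_congr fun m => ?_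
        have hm : (0 : ℝ) < (m : ℝ) + 1 := by positivity
        have hq : ‖-(y ^ 2 / ((m : ℝ) + 1) ^ 2)‖ < 1 := by
          rw [norm_neg, Real.norm_of_nonneg (by positivity), div_lt_one (by positivity)]
          nlinarith [Nat.cast_nonneg (α := ℝ) m]
        have hf : ∀ n, f m n =
            2 * y / ((m : ℝ) + 1) ^ 2 * (-(y ^ 2 / ((m : ℝ) + 1) ^ 2)) ^ n := fun n => by
          simp only [f]
          rw [neg_pow (y ^ 2 / _), div_pow, ← pow_mul, ← pow_mul]
          field_simp
          ring
        simp_rw [hf]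
        rw [tsum_mul_left, tsum_geometric_of_norm_lt_one hq]
        rw [sub_neg_eq_add]
        field_simp
        ring
    _ = ∑' n, ∑' m, f m n := (hs.tsum_comm).symm
    _ = _ := by
        refine tsum_congr fun n => ?_
        simp only [f]
        rw [tsum_mul_left, cothCoeff, realZeta]
        ring

lemma pi_mul_coth_eq {y : ℝ} (hy0 : y ≠ 0) :
    π * (cosh (π * y) / sinh (π * y)) =
      1 / y + ∑' m : ℕ, 2 * y / (y ^ 2 + ((m : ℝ) + 1) ^ 2) := by
  have hmem : (y : ℂ) * Complex.I ∈ Complex.integerComplement := by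
    rw [Complex.mem_integerComplement_iff]
    rintro ⟨n, hn⟩
    apply hy0
    simpa using (congrArg Complex.im hn).symm
  have h := cot_series_rep' hmem
  have hcot : Complex.cot (π * (y * Complex.I)) =
      -Complex.I * ((cosh (π * y) / sinh (π * y) : ℝ) : ℂ) := by
    rw [Complex.cot, ← mul_assoc, Complex.cos_mul_I, Complex.sin_mul_I]
    push_cast
    rw [div_mul_eq_div_div_swap, Complex.div_I]
    ring
  have hterm : ∀ m : ℕ, 1 / ((y : ℂ) * Complex.I - (m + 1)) + 1 / ((y : ℂ) * Complex.I + (m + 1)) =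
      -Complex.I * ((2 * y / (y ^ 2 + ((m : ℝ) + 1) ^ 2) : ℝ) : ℂ) := fun m => by
    have h1 : (y : ℂ) * Complex.I - (m + 1) ≠ 0 := fun h => hy0 (by
      simpa using congrArg Complex.im h)
    have h2 : (y : ℂ) * Complex.I + (m + 1) ≠ 0 := fun h => hy0 (by
      simpa using congrArg Complex.im h)
    have h3 : ((y : ℂ) ^ 2 + ((m : ℂ) + 1) ^ 2) ≠ 0 := by
      have : y ^ 2 + ((m : ℝ) + 1) ^ 2 ≠ 0 := by positivity
      exact_mod_cast this
    push_cast
    rw [div_add_div _ _ h1 h2, mul_div_assoc', div_eq_div_iff (mul_ne_zero h1 h2) h3]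
    linear_combination (2 * (y : ℂ) ^ 3 * Complex.I) * Complex.I_sq
  simp_rw [hterm] at h
  rw [hcot, tsum_mul_left, ← Complex.ofReal_tsum] at h
  have hinv : 1 / ((y : ℂ) * Complex.I) = -Complex.I * ((1 / y : ℝ) : ℂ) := by
    rw [div_mul_eq_div_div, Complex.div_I]
    push_cast
    ring
  rw [hinv] at h
  have h5 : -Complex.I * ((π * (cosh (π * y) / sinh (π * y)) : ℝ) : ℂ) =
      -Complex.I * ((1 / y + ∑' m : ℕ, 2 * y / (y ^ 2 + ((m : ℝ) + 1) ^ 2) : ℝ) : ℂ) := by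
    rw [Complex.ofReal_mul, Complex.ofReal_add]
    linear_combination h
  exact_mod_cast mul_left_cancel₀ (neg_ne_zero.2 Complex.I_ne_zero) h5

lemma hasDerivAt_pi_mul_coth {y : ℝ} (hy0 : y ≠ 0) :
    HasDerivAt (fun z => π * (cosh (π * z) / sinh (π * z)))
      (π ^ 2 - (π * (cosh (π * y) / sinh (π * y))) ^ 2) y := by
  have hs : sinh (π * y) ≠ 0 := by
    rw [Ne, Real.sinh_eq_zero]
    exact mul_ne_zero pi_ne_zero hy0
  have hl : HasDerivAt (fun z => π * z) π y := by
    simpa using (hasDerivAt_id y).const_mul π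
  refine ((hl.cosh.div hl.sinh hs).const_mul π).congr_deriv ?_
  field_simp

lemma pi_mul_coth_cube_eq {y : ℝ} (hy0 : y ≠ 0) (hy : |y| < 1) :
    (π * (cosh (π * y) / sinh (π * y))) ^ 3 = π ^ 2 / y + 1 / y ^ 3 +
      ∑' n : ℕ, (π ^ 2 * cothCoeff n + ((n : ℝ) + 1) * (2 * n + 3) * cothCoeff (n + 1)) *
        y ^ (2 * n + 1) := by
  set f : ℝ → ℝ := fun z => π * (cosh (π * z) / sinh (π * z)) with hf
  set b' : ℕ → ℝ := fun n => cothCoeff n * (2 * n + 1 : ℕ) with hb'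
  have bound' : ∀ n, |b' n| ≤ 2 * (2 * realZeta 2) * ((n : ℝ) + 1) ^ (0 + 1) :=
    abs_mul_exponent_le (e := fun n => 2 * n + 1) abs_cothCoeff_le fun n => le_rfl
  have bound'' := abs_mul_exponent_le (e := fun n => 2 * n) bound' fun n => by omega
  have near : ∀ᶠ z in nhds y, z ≠ 0 ∧ |z| < 1 :=
    (eventually_ne_nhds hy0).and
      ((isOpen_lt continuous_abs continuous_const).mem_nhds hy)
  have series : ∀ z, z ≠ 0 → |z| < 1 → f z = z⁻¹ + ∑' n, cothCoeff n * z ^ (2 * n + 1) :=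
    fun z hz0 hz1 => by
      rw [hf, ← tsum_partial_fractions_eq hz1, ← one_div]
      exact pi_mul_coth_eq hz0
  have deriv_series : ∀ z, z ≠ 0 → |z| < 1 →
      π ^ 2 - f z ^ 2 = -(z ^ 2)⁻¹ + ∑' n, b' n * z ^ (2 * n) := fun z hz0 hz1 => by
    have near_z : ∀ᶠ w in nhds z, w ≠ 0 ∧ |w| < 1 :=
      (eventually_ne_nhds hz0).and
        ((isOpen_lt continuous_abs continuous_const).mem_nhds hz1)
    refine (hasDerivAt_pi_mul_coth hz0).unique
      (((hasDerivAt_inv hz0).add (hasDerivAt_tsum_mul_pow (e := fun n => 2 * n + 1)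
        abs_cothCoeff_le (fun n => by omega) (fun n => le_rfl) hz1)).congr_of_eventuallyEq ?_)
    filter_upwards [near_z] with w hw using series w hw.1 hw.2
  have second : -(2 * f y * (π ^ 2 - f y ^ 2)) =
      2 / y ^ 3 + ∑' n, b' n * (2 * n : ℕ) * y ^ (2 * n - 1) := by
    have h1 : HasDerivAt (fun z => π ^ 2 - f z ^ 2) (-(2 * f y * (π ^ 2 - f y ^ 2))) y := by
      simpa using ((hasDerivAt_pi_mul_coth hy0).pow 2).const_sub (π ^ 2)
    have h2 : HasDerivAt (fun z : ℝ => -(z ^ 2)⁻¹) (2 / y ^ 3) y := by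
      refine ((hasDerivAt_pow 2 y).inv (pow_ne_zero 2 hy0)).neg.congr_deriv ?_
      field_simp
      simp [mul_comm]
    refine h1.unique ((h2.add (hasDerivAt_tsum_mul_pow (e := fun n => 2 * n)
        bound' (fun n => by omega) (fun n => by omega) hy)).congr_of_eventuallyEq ?_)
    filter_upwards [near] with w hw using deriv_series w hw.1 hw.2
  have s1 : Summable fun n => cothCoeff n * y ^ (2 * n + 1) :=
    (summable_norm_mul_pow (e := fun n => 2 * n + 1) abs_cothCoeff_le (fun n => by omega) hy).of_norm
  have s2 : Summable fun n => b' n * (2 * n : ℕ) * y ^ (2 * n - 1) :=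
    (summable_norm_mul_pow (e := fun n => 2 * n - 1) bound'' (fun n => by omega) hy).of_norm
  rw [s2.tsum_eq_zero_add] at second
  have s2' := (summable_nat_add_iff 1).2 s2
  have split : ∑' n : ℕ, (π ^ 2 * cothCoeff n + ((n : ℝ) + 1) * (2 * n + 3) * cothCoeff (n + 1)) *
        y ^ (2 * n + 1) = π ^ 2 * ∑' n, cothCoeff n * y ^ (2 * n + 1) +
      1 / 2 * ∑' n, b' (n + 1) * (2 * (n + 1) : ℕ) * y ^ (2 * (n + 1) - 1) := by
    rw [← tsum_mul_left, ← tsum_mul_left, ← (s1.mul_left _).tsum_add (s2'.mul_left _)]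
    refine tsum_congr fun n => ?_
    rw [show 2 * (n + 1) - 1 = 2 * n + 1 by omega]
    simp only [hb']
    push_cast
    ring
  rw [split]
  have h := series y hy0 hy
  change f y ^ 3 = _
  simp only [mul_zero, Nat.cast_zero, zero_mul, zero_add] at second
  linear_combination 1 / 2 * second + π ^ 2 * h

/-- For real `x` with `0 < |x| < π`,
`coth³ x = 1/x³ + 1/x + (2/π) ∑_{n=0}^∞ (-1)^(n+1)
  [(1/π²)(n+1)(2n+3) ζ(2n+4) - ζ(2n+2)] (x/π)^(2n+1)`,
the series converging absolutely. -/
theorem coth_cube_laurent_series (x : ℝ) (hx0 : 0 < |x|) (hx : |x| < π) :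
    Summable (fun n : ℕ => ‖(-1 : ℂ) ^ (n + 1) *
      ((1 / (π : ℂ) ^ 2) * ((n : ℂ) + 1) * (2 * (n : ℂ) + 3) * riemannZeta (2 * (n : ℂ) + 4) -
        riemannZeta (2 * (n : ℂ) + 2)) *
      (((x / π) ^ (2 * n + 1) : ℝ) : ℂ)‖) ∧
    (((Real.cosh x / Real.sinh x) ^ 3 : ℝ) : ℂ) =
      1 / (x : ℂ) ^ 3 + 1 / (x : ℂ) + (2 / (π : ℂ)) *
      ∑' n : ℕ, (-1 : ℂ) ^ (n + 1) *
        ((1 / (π : ℂ) ^ 2) * ((n : ℂ) + 1) * (2 * (n : ℂ) + 3) * riemannZeta (2 * (n : ℂ) + 4) -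
          riemannZeta (2 * (n : ℂ) + 2)) *
        (((x / π) ^ (2 * n + 1) : ℝ) : ℂ) := by
  have hx0' : x ≠ 0 := abs_pos.1 hx0
  have hy0 : x / π ≠ 0 := div_ne_zero hx0' pi_ne_zero
  have hy : |x / π| < 1 := by rwa [abs_div, abs_of_pos pi_pos, div_lt_one pi_pos]
  set c : ℕ → ℝ := fun n =>
    π ^ 2 * cothCoeff n + ((n : ℝ) + 1) * (2 * n + 3) * cothCoeff (n + 1) with hcdef
  have hterm : ∀ n : ℕ, (-1 : ℂ) ^ (n + 1) *
      ((1 / (π : ℂ) ^ 2) * ((n : ℂ) + 1) * (2 * (n : ℂ) + 3) * riemannZeta (2 * (n : ℂ) + 4) -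
        riemannZeta (2 * (n : ℂ) + 2)) * (((x / π) ^ (2 * n + 1) : ℝ) : ℂ) =
      ((1 / (2 * π ^ 2) * (c n * (x / π) ^ (2 * n + 1)) : ℝ) : ℂ) := fun n => by
    have h4 := riemannZeta_eq_realZeta (show 2 ≤ 2 * (n + 1) + 2 by omega)
    have h2 := riemannZeta_eq_realZeta (show 2 ≤ 2 * n + 2 by omega)
    push_cast at h4 h2
    rw [show 2 * ((n : ℂ) + 1) + 2 = 2 * n + 4 by ring] at h4
    rw [h4, h2]
    simp only [hcdef, cothCoeff]
    push_cast
    field_simp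
    ring
  have hbound : ∀ n : ℕ, |c n| ≤ (2 * π ^ 2 + 6) * realZeta 2 * ((n : ℝ) + 1) ^ 2 := fun n => by
    have h1 : |cothCoeff n| ≤ 2 * realZeta 2 := by simpa using abs_cothCoeff_le n
    have h2 : |cothCoeff (n + 1)| ≤ 2 * realZeta 2 := by simpa using abs_cothCoeff_le (n + 1)
    have hn : (0 : ℝ) ≤ n := Nat.cast_nonneg n
    have hz := realZeta_nonneg 2
    calc |c n| ≤ |π ^ 2 * cothCoeff n| + |((n : ℝ) + 1) * (2 * n + 3) * cothCoeff (n + 1)| :=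
          abs_add_le _ _
      _ = π ^ 2 * |cothCoeff n| + ((n : ℝ) + 1) * (2 * n + 3) * |cothCoeff (n + 1)| := by
          rw [abs_mul, abs_mul, abs_of_nonneg (sq_nonneg π),
            abs_of_nonneg (show 0 ≤ ((n : ℝ) + 1) * (2 * n + 3) by positivity)]
      _ ≤ π ^ 2 * (2 * realZeta 2) * ((n : ℝ) + 1) ^ 2 +
          ((n : ℝ) + 1) * (3 * (n + 1)) * (2 * realZeta 2) := by
          refine add_le_add ?_ ?_
          · calc π ^ 2 * |cothCoeff n| ≤ π ^ 2 * (2 * realZeta 2) := by gcongr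
              _ ≤ _ := le_mul_of_one_le_right (by positivity) (by nlinarith)
          · have : 2 * (n : ℝ) + 3 ≤ 3 * (n + 1) := by linarith
            gcongr
      _ = _ := by ring
  have hsum := summable_norm_mul_pow (e := fun n => 2 * n + 1) hbound (fun n => by omega) hy
  simp_rw [hterm]
  constructor
  · simp_rw [Complex.norm_real]
    exact (hsum.of_norm.mul_left _).norm
  · rw [← Complex.ofReal_tsum, tsum_mul_left]
    have h := pi_mul_coth_cube_eq hy0 hy
    rw [mul_div_cancel₀ x pi_ne_zero] at h
    have key : (cosh x / sinh x) ^ 3 = 1 / x ^ 3 + 1 / x +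
        2 / π * (1 / (2 * π ^ 2) * ∑' n, c n * (x / π) ^ (2 * n + 1)) := by
      have h3 : (cosh x / sinh x) ^ 3 = (π * (cosh x / sinh x)) ^ 3 / π ^ 3 := by
        rw [mul_pow, mul_div_cancel_left₀ _ (pow_ne_zero 3 pi_ne_zero)]
      rw [h3, h]
      change (_ + ∑' n, c n * (x / π) ^ (2 * n + 1)) / π ^ 3 = _
      generalize ∑' n, c n * (x / π) ^ (2 * n + 1) = S
      field_simp
      ring
    rw [key]
    push_cast
    rfl
end
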